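/- (Gordon–Webb–Wolpert: one cannot hear the shape of a drum, Dirichlet case) Let Ω_A ⊆ ℝ² be the open region bounded by the simple closed polygonal curve through the vertices (0,0), (1,0), (1.5,0.5), (2,0), (2,1), (1.5,1.5), (0.5,0.5), (0,1) taken in this order, and let Ω_B ⊆ ℝ² be the open region bounded by the simple closed polygonal curve through the vertices (0,0), (0.5,−0.5), (1,0), (0.5,0.5), (1,1), (1,2), (0.5,1.5), (0,2) taken in this order. Then there is no isometry of ℝ² mapping Ω_A onto Ω_B, yet λ_k(Ω_A) = λ_k(Ω_B) for every integer k ≥ 1; i.e., Ω_A and Ω_B are non-isometric but Dirichlet isospectral. -/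

import Mathlib

open MeasureTheory Real

/-- The k-th Dirichlet eigenvalue of the Laplacian on `Ω ⊆ ℝⁿ`, defined variationally as
the infimum, over all `k`-dimensional subspaces `E` of the space of smooth compactly
supported functions with support in `Ω`, of the supremum of the Rayleigh quotient
`(∫_Ω ‖∇u‖²) / (∫_Ω u²)` over nonzero `u ∈ E`. -/
noncomputable def dirichletEig {n : ℕ} (Ω : Set (EuclideanSpace ℝ (Fin n))) (k : ℕ) : ℝ :=
  sInf { r : ℝ | ∃ E : Submodule ℝ (EuclideanSpace ℝ (Fin n) → ℝ),
    Module.finrank ℝ E = k ∧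
    (∀ u ∈ E, ContDiff ℝ (⊤ : ℕ∞) u ∧ HasCompactSupport u ∧ tsupport u ⊆ Ω) ∧
    r = sSup { q : ℝ | ∃ u ∈ E, u ≠ (0 : EuclideanSpace ℝ (Fin n) → ℝ) ∧
        q = (∫ x in Ω, ‖gradient u x‖ ^ 2) / (∫ x in Ω, (u x) ^ 2) } }

/-- The point `(a, b)` of the Euclidean plane. -/
noncomputable def pt (a b : ℝ) : EuclideanSpace ℝ (Fin 2) :=
  (WithLp.equiv 2 (Fin 2 → ℝ)).symm ![a, b]

/-- The closed triangle with vertices `p`, `q`, `s`. -/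
noncomputable def tri (p q s : EuclideanSpace ℝ (Fin 2)) : Set (EuclideanSpace ℝ (Fin 2)) :=
  convexHull ℝ ({p, q, s} : Set (EuclideanSpace ℝ (Fin 2)))

/-- The open region bounded by the simple closed polygonal curve through the vertices
`(0,0), (1,0), (1.5,0.5), (2,0), (2,1), (1.5,1.5), (0.5,0.5), (0,1)` (taken in this order),
realized as the interior of the union of seven closed triangles triangulating it. -/
noncomputable def gwwA : Set (EuclideanSpace ℝ (Fin 2)) :=
  interior (tri (pt 0 0) (pt 0.5 0.5) (pt 0 1) ∪ tri (pt 0 0) (pt 1 0) (pt 0.5 0.5) ∪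
    tri (pt 1 0) (pt 1 1) (pt 0.5 0.5) ∪ tri (pt 1 0) (pt 1.5 0.5) (pt 1 1) ∪
    tri (pt 1.5 0.5) (pt 2 0) (pt 2 1) ∪ tri (pt 1 1) (pt 1.5 0.5) (pt 2 1) ∪
    tri (pt 1 1) (pt 2 1) (pt 1.5 1.5))

/-- The open region bounded by the simple closed polygonal curve through the vertices
`(0,0), (0.5,−0.5), (1,0), (0.5,0.5), (1,1), (1,2), (0.5,1.5), (0,2)` (taken in this order),
realized as the interior of the union of seven closed triangles triangulating it. -/
noncomputable def gwwB : Set (EuclideanSpace ℝ (Fin 2)) :=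
  interior (tri (pt 0 0) (pt 0.5 (-0.5)) (pt 1 0) ∪ tri (pt 0 0) (pt 1 0) (pt 0.5 0.5) ∪
    tri (pt 0 0) (pt 0.5 0.5) (pt 0 1) ∪ tri (pt 0 1) (pt 0.5 0.5) (pt 1 1) ∪
    tri (pt 0 1) (pt 1 1) (pt 0.5 1.5) ∪ tri (pt 0.5 1.5) (pt 1 1) (pt 1 2) ∪
    tri (pt 0 1) (pt 0.5 1.5) (pt 0 2))

section SmoothApproximation

open Filter Topology Set Function Metric
open scoped Convolution NNReal

variable {E : Type*} [NormedAddCommGroup E] [InnerProductSpace ℝ E] [FiniteDimensional ℝ E]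
  [MeasurableSpace E] [BorelSpace E]

/-- A Lipschitz function has zero derivative at almost every point of its zero set. -/
theorem LipschitzWith.ae_hasFDerivAt_zero_of_eq_zero {v : E → ℝ} {L : ℝ≥0}
    (hv : LipschitzWith L v) : ∀ᵐ x, v x = 0 → HasFDerivAt v (0 : E →L[ℝ] ℝ) x := by
  have habs : LipschitzWith L (fun x => |v x|) := by
    refine LipschitzWith.of_dist_le_mul fun x y => ?_
    rw [Real.dist_eq]
    exact (abs_abs_sub_abs_le _ _).trans (by simpa [Real.dist_eq] using hv.dist_le_mul x y)
  filter_upwards [habs.ae_differentiableAt (μ := volume)] with x hx h0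
  have hmin : IsLocalMin (fun y => |v y|) x := by
    refine Eventually.of_forall fun y => ?_
    simp [h0]
  have h := hx.hasFDerivAt
  rw [hmin.fderiv_eq_zero, hasFDerivAt_iff_isLittleO] at h
  rw [hasFDerivAt_iff_isLittleO]
  simp only [h0, abs_zero, sub_zero, zero_apply] at h ⊢
  exact Asymptotics.isLittleO_norm_left.1 (by simpa only [Real.norm_eq_abs] using h)

/-- Soft thresholding at level `ε`. -/
noncomputable def softThreshold (ε t : ℝ) : ℝ := max (t - ε) 0 + min (t + ε) 0

theorem softThreshold_lipschitz {ε : ℝ} (hε : 0 ≤ ε) : LipschitzWith 1 (softThreshold ε) := by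
  refine LipschitzWith.of_dist_le_mul fun s t => ?_
  simp only [Real.dist_eq, softThreshold, NNReal.coe_one, one_mul]
  rcases max_cases (s - ε) 0 with h1 | h1 <;> rcases max_cases (t - ε) 0 with h2 | h2 <;>
  rcases min_cases (s + ε) 0 with h3 | h3 <;> rcases min_cases (t + ε) 0 with h4 | h4 <;>
  rw [h1.1, h2.1, h3.1, h4.1] <;> rcases abs_cases (s - t) with h5 | h5 <;> rw [h5.1] <;>
  rw [abs_le] <;> constructor <;> linarith

theorem softThreshold_eq_zero {ε t : ℝ} (h : |t| ≤ ε) : softThreshold ε t = 0 := by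
  have := abs_le.1 h
  simp only [softThreshold]
  rw [max_eq_right (by linarith), min_eq_right (by linarith), add_zero]

theorem softThreshold_of_le {ε t : ℝ} (hε : 0 ≤ ε) (h : ε ≤ t) : softThreshold ε t = t - ε := by
  simp only [softThreshold]
  rw [max_eq_left (by linarith), min_eq_right (by linarith), add_zero]

theorem softThreshold_of_le_neg {ε t : ℝ} (hε : 0 ≤ ε) (h : t ≤ -ε) :
    softThreshold ε t = t + ε := by
  simp only [softThreshold]
  rw [max_eq_right (by linarith), min_eq_left (by linarith), zero_add]

theorem abs_softThreshold_sub_le {ε t : ℝ} (hε : 0 ≤ ε) : |softThreshold ε t - t| ≤ ε := by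
  simp only [softThreshold]
  rcases max_cases (t - ε) 0 with h1 | h1 <;> rcases min_cases (t + ε) 0 with h3 | h3 <;>
  rw [h1.1, h3.1, abs_le] <;> constructor <;> linarith

theorem fderiv_softThreshold_comp {E : Type*} [NormedAddCommGroup E] [InnerProductSpace ℝ E]
    {v : E → ℝ} (hv : Continuous v) {ε : ℝ} (hε : 0 ≤ ε) {y : E}
    (hy : ε < |v y|) : fderiv ℝ (fun z => softThreshold ε (v z)) y = fderiv ℝ v y := by
  rcases lt_abs.1 hy with h | h
  · have : (fun z => softThreshold ε (v z)) =ᶠ[𝓝 y] fun z => v z - ε := by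
      filter_upwards [hv.continuousAt.eventually (lt_mem_nhds h)] with z hz
      exact softThreshold_of_le hε (le_of_lt hz)
    rw [this.fderiv_eq, fderiv_sub_const]
  · have h' : v y < -ε := by linarith
    have : (fun z => softThreshold ε (v z)) =ᶠ[𝓝 y] fun z => v z + ε := by
      filter_upwards [hv.continuousAt.eventually (gt_mem_nhds h')] with z hz
      exact softThreshold_of_le_neg hε (le_of_lt hz)
    rw [this.fderiv_eq, fderiv_add_const]

/-- The derivative of the convolution of a bump function with a Lipschitz function. -/
theorem hasFDerivAt_normed_convolution (φ : ContDiffBump (0 : E)) {g : E → ℝ} {L : ℝ≥0}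
    (hg : LipschitzWith L g) (x : E) :
    HasFDerivAt (φ.normed volume ⋆[ContinuousLinearMap.lsmul ℝ ℝ, volume] g : E → ℝ)
      ((φ.normed volume ⋆[ContinuousLinearMap.lsmul ℝ ℝ, volume] fderiv ℝ g : E → E →L[ℝ] ℝ) x)
      x := by
  have hφc : Continuous (φ.normed volume) := φ.continuous_normed
  have hφi : Integrable (φ.normed volume) (volume : Measure E) :=
    hφc.integrable_of_hasCompactSupport φ.hasCompactSupport_normed
  have hd : ∀ᵐ t : E, DifferentiableAt ℝ g (x - t) := by
    have hmp : MeasurePreserving (fun t : E => x - t) volume volume :=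
      Measure.measurePreserving_sub_left volume x
    exact hmp.quasiMeasurePreserving.ae (hg.ae_differentiableAt (μ := volume))
  have key := hasFDerivAt_integral_of_dominated_loc_of_lip (μ := (volume : Measure E))
    (F := fun y t => φ.normed volume t • g (y - t))
    (F' := fun t => φ.normed volume t • fderiv ℝ g (x - t)) (s := univ) (x₀ := x)
    (bound := fun t => φ.normed volume t * L) univ_mem
    (Eventually.of_forall fun y =>
      (hφc.smul (hg.continuous.comp (continuous_const.sub continuous_id))).aestronglyMeasurable)
    ((hφc.smul (hg.continuous.comp
      (continuous_const.sub continuous_id))).integrable_of_hasCompactSupport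
        φ.hasCompactSupport_normed.smul_right)
    (hφc.aestronglyMeasurable.smul
      ((measurable_fderiv ℝ g).comp (measurable_const.sub measurable_id)).aestronglyMeasurable)
    (Eventually.of_forall fun t => by
      refine (LipschitzWith.of_dist_le_mul fun y z => ?_).lipschitzOnWith
      have hn : 0 ≤ φ.normed volume t := φ.nonneg_normed t
      have h1 := hg.dist_le_mul (y - t) (z - t)
      rw [dist_sub_right, Real.dist_eq] at h1
      rw [Real.dist_eq, smul_eq_mul, smul_eq_mul, ← mul_sub, abs_mul, abs_of_nonneg hn,
        Real.coe_nnabs, abs_of_nonneg (mul_nonneg hn L.coe_nonneg), mul_assoc]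
      exact mul_le_mul_of_nonneg_left h1 hn)
    (hφi.mul_const _)
    (by
      filter_upwards [hd] with t ht
      have := (ht.hasFDerivAt.comp x ((hasFDerivAt_id x).sub_const t)).const_smul
        (φ.normed volume t)
      simpa [Function.comp_def, Pi.smul_def] using this)
  have h2 := key.2
  simp only [convolution_def, ContinuousLinearMap.lsmul_apply] 
  exact h2

theorem lipschitzWith_normed_convolution (φ : ContDiffBump (0 : E)) {g : E → ℝ} {L : ℝ≥0}
    (hg : LipschitzWith L g) : LipschitzWith L
      (φ.normed volume ⋆[ContinuousLinearMap.lsmul ℝ ℝ, volume] g : E → ℝ) := by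
  have hφc : Continuous (φ.normed volume) := φ.continuous_normed
  have hφi : Integrable (φ.normed volume) (volume : Measure E) :=
    hφc.integrable_of_hasCompactSupport φ.hasCompactSupport_normed
  refine LipschitzWith.of_dist_le_mul fun x y => ?_
  have hi : ∀ z, Integrable (fun t => φ.normed volume t • g (z - t)) := fun z =>
    (hφc.smul (hg.continuous.comp
      (continuous_const.sub continuous_id))).integrable_of_hasCompactSupport
        φ.hasCompactSupport_normed.smul_right
  simp only [convolution_def, ContinuousLinearMap.lsmul_apply]
  rw [dist_eq_norm, ← integral_sub (hi x) (hi y)]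
  calc _ ≤ ∫ t, φ.normed volume t * (L * dist x y) := by
        refine norm_integral_le_of_norm_le (hφi.mul_const _) (Eventually.of_forall fun t => ?_)
        have hn : 0 ≤ φ.normed volume t := φ.nonneg_normed t
        have h1 := hg.dist_le_mul (x - t) (y - t)
        rw [dist_sub_right, Real.dist_eq] at h1
        rw [← smul_sub, norm_smul, Real.norm_of_nonneg hn, Real.norm_eq_abs]
        exact mul_le_mul_of_nonneg_left h1 hn
    _ = L * dist x y := by
        rw [integral_mul_const, φ.integral_normed, one_mul]

theorem normed_convolution_congr (φ : ContDiffBump (0 : E)) {F : Type*} [NormedAddCommGroup F]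
    [NormedSpace ℝ F] {g h : E → F} {x : E} (hgh : ∀ y ∈ ball x φ.rOut, g y = h y) :
    (φ.normed volume ⋆[ContinuousLinearMap.lsmul ℝ ℝ, volume] g : E → F) x =
      (φ.normed volume ⋆[ContinuousLinearMap.lsmul ℝ ℝ, volume] h : E → F) x := by
  simp only [convolution_def, ContinuousLinearMap.lsmul_apply]
  refine integral_congr_ae (Eventually.of_forall fun t => ?_)
  by_cases ht : t ∈ ball (0 : E) φ.rOut
  · simp only
    rw [hgh (x - t) (by simpa using ht)]
  · have : φ.normed volume t = 0 := by
      rw [← notMem_support, φ.support_normed_eq]; exact ht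
    simp [this]

/-- A Lipschitz function vanishing outside a bounded open set is a limit, together with its
derivative and with uniform bounds, of smooth functions with compact support in that set. -/
theorem LipschitzWith.exists_smooth_approx {v : E → ℝ} {L : ℝ≥0} (hv : LipschitzWith L v)
    {Ω : Set E} (hb : Bornology.IsBounded Ω) (h0 : ∀ x ∉ Ω, v x = 0) :
    ∃ w : ℕ → E → ℝ, (∀ n, ContDiff ℝ (⊤ : ℕ∞) (w n) ∧ HasCompactSupport (w n) ∧
        tsupport (w n) ⊆ Ω ∧ LipschitzWith L (w n)) ∧
      (∃ C, ∀ n x, |w n x| ≤ C) ∧ (∀ x, Tendsto (fun n => w n x) atTop (𝓝 (v x))) ∧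
      ∀ᵐ x, Tendsto (fun n => fderiv ℝ (w n) x) atTop (𝓝 (fderiv ℝ v x)) := by
  have hvc := hv.continuous
  set K : ℝ := L + 1 with hK
  have hKpos : 0 < K := by positivity
  have hvK : ∀ x y, |v x - v y| ≤ K * dist x y := fun x y => by
    have := hv.dist_le_mul x y
    rw [Real.dist_eq] at this
    nlinarith [dist_nonneg (x := x) (y := y)]
  set ε : ℕ → ℝ := fun n => 1 / ((n : ℝ) + 1) with hε
  have hεpos : ∀ n, 0 < ε n := fun n => by positivity
  have hεle : ∀ n, ε n ≤ 1 := fun n => by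
    rw [hε]; simp only; rw [div_le_one (by positivity)]; linarith [Nat.cast_nonneg (α := ℝ) n]
  have hεlim : Tendsto ε atTop (𝓝 0) := tendsto_one_div_add_atTop_nhds_zero_nat
  let φ : ℕ → ContDiffBump (0 : E) := fun n =>
    ⟨ε n / (4 * K), ε n / (2 * K), by have := hεpos n; positivity, by
      have := hεpos n
      gcongr; norm_num⟩
  have hφout : ∀ n, (φ n).rOut = ε n / (2 * K) := fun n => rfl
  have hKout : ∀ n, K * (φ n).rOut = ε n / 2 := fun n => by rw [hφout]; field_simp
  have hφlim : Tendsto (fun n => (φ n).rOut) atTop (𝓝 0) := by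
    have := hεlim.div_const (2 * K)
    simpa [hφout] using this
  have hφratio : ∀ n, (φ n).rOut ≤ 2 * (φ n).rIn := fun n => by
    change ε n / (2 * K) ≤ 2 * (ε n / (4 * K))
    apply le_of_eq; field_simp; norm_num
  set s : ℕ → E → ℝ := fun n x => softThreshold (ε n) (v x) with hs
  have hsL : ∀ n, LipschitzWith L (s n) := fun n => by
    have := (softThreshold_lipschitz (hεpos n).le).comp hv
    rwa [one_mul] at this
  set w : ℕ → E → ℝ := fun n =>
    ((φ n).normed volume ⋆[ContinuousLinearMap.lsmul ℝ ℝ, volume] s n : E → ℝ) with hw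
  have hball : ∀ n x, ∀ y ∈ ball x (φ n).rOut, |v y - v x| ≤ ε n / 2 := fun n x y hy => by
    rw [← hKout]
    exact (hvK y x).trans (by gcongr; exact (mem_ball.1 hy).le)
  have hwzero : ∀ n x, |v x| < ε n / 2 → w n x = 0 := fun n x hx => by
    have : w n x = ((φ n).normed volume ⋆[ContinuousLinearMap.lsmul ℝ ℝ, volume]
        (fun _ => (0 : ℝ)) : E → ℝ) x := by
      refine normed_convolution_congr _ fun y hy => softThreshold_eq_zero ?_
      have := hball n x y hy
      have h2 := abs_sub_abs_le_abs_sub (v y) (v x)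
      linarith
    rw [this]; simp [convolution_def]
  have hclosed : ∀ n, IsClosed {x | ε n / 2 ≤ |v x|} := fun n =>
    isClosed_le continuous_const hvc.abs
  have htsupp : ∀ n, tsupport (w n) ⊆ {x | ε n / 2 ≤ |v x|} := fun n => by
    refine closure_minimal (fun x hx => ?_) (hclosed n)
    by_contra h
    exact hx (hwzero n x (not_le.1 h))
  have hsub : ∀ n, {x | ε n / 2 ≤ |v x|} ⊆ Ω := fun n x hx => by
    by_contra h
    have h1 := hεpos n
    have h2 : ε n / 2 ≤ |v x| := hx
    rw [h0 x h, abs_zero] at h2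
    linarith
  have hdist : ∀ n x, |w n x - v x| ≤ 2 * ε n := fun n x => by
    have h1 : dist (w n x) (s n x) ≤ ε n / 2 := by
      refine (φ n).dist_normed_convolution_le (hsL n).continuous.aestronglyMeasurable
        fun y hy => ?_
      have h2 := (softThreshold_lipschitz (hεpos n).le).dist_le_mul (v y) (v x)
      rw [NNReal.coe_one, one_mul, Real.dist_eq (v y)] at h2
      exact h2.trans (hball n x y hy)
    rw [Real.dist_eq] at h1
    have h2 : |s n x - v x| ≤ ε n := abs_softThreshold_sub_le (hεpos n).le
    have h3 := abs_sub_le (w n x) (s n x) (v x)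
    linarith [hεpos n]
  refine ⟨w, fun n => ⟨?_, ?_, (htsupp n).trans (hsub n),
    lipschitzWith_normed_convolution _ (hsL n)⟩, ?_, ?_, ?_⟩
  · exact (φ n).hasCompactSupport_normed.contDiff_convolution_left _ (φ n).contDiff_normed
      (hsL n).continuous.locallyIntegrable
  · exact (Metric.isCompact_of_isClosed_isBounded (hclosed n) (hb.subset (hsub n))).of_isClosed_subset
      (isClosed_tsupport _) (htsupp n)
  · have hcs : HasCompactSupport v := by
      refine HasCompactSupport.intro (hb.isCompact_closure) fun x hx => h0 x fun h => hx ?_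
      exact subset_closure h
    obtain ⟨C, hC⟩ := hcs.exists_bound_of_continuous hvc
    refine ⟨C + 2, fun n x => ?_⟩
    have h1 := hdist n x
    have h2 := hC x
    rw [Real.norm_eq_abs] at h2
    have h3 := abs_sub_abs_le_abs_sub (w n x) (v x)
    linarith [hεle n]
  · intro x
    rw [tendsto_iff_dist_tendsto_zero]
    have h2 : Tendsto (fun n => 2 * ε n) atTop (𝓝 0) := by simpa using hεlim.const_mul 2
    exact squeeze_zero (fun n => dist_nonneg)
      (fun n => by rw [Real.dist_eq]; exact hdist n x) h2
  · have hloc : LocallyIntegrable (fderiv ℝ v) (volume : Measure E) := by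
      refine (locallyIntegrable_const (L : ℝ)).mono
        (measurable_fderiv ℝ v).aestronglyMeasurable (Eventually.of_forall fun x => ?_)
      simpa using norm_fderiv_le_of_lipschitz ℝ hv
    filter_upwards [ContDiffBump.ae_convolution_tendsto_right_of_locallyIntegrable hφlim
      (Eventually.of_forall hφratio) hloc, hv.ae_hasFDerivAt_zero_of_eq_zero] with x hx hx0
    by_cases hvx : v x = 0
    · rw [(hx0 hvx).fderiv]
      refine tendsto_const_nhds.congr fun n => ?_
      have : w n =ᶠ[𝓝 x] fun _ => 0 := by
        have hopen : ∀ᶠ y in 𝓝 x, |v y| < ε n / 2 := by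
          refine hvc.abs.continuousAt.eventually (gt_mem_nhds ?_)
          simp only [hvx, abs_zero]; linarith [hεpos n]
        exact hopen.mono fun y hy => hwzero n y hy
      rw [this.fderiv_eq]; simp
    · refine hx.congr' ?_
      have : ∀ᶠ n in atTop, 2 * ε n < |v x| := by
        have h2 : Tendsto (fun n => 2 * ε n) atTop (𝓝 0) := by simpa using hεlim.const_mul 2
        exact h2.eventually (gt_mem_nhds (abs_pos.2 hvx))
      filter_upwards [this] with n hn
      rw [(hasFDerivAt_normed_convolution (φ n) (hsL n) x).fderiv]
      refine normed_convolution_congr _ fun y hy => ?_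
      refine (fderiv_softThreshold_comp hvc (hεpos n).le ?_).symm
      have h1 := hball n x y hy
      have h2 := abs_sub_abs_le_abs_sub (v x) (v y)
      rw [abs_sub_comm] at h1
      linarith [hεpos n]

end SmoothApproximation

section QuadraticForms

open Filter Topology Set Function Metric

variable {ι : Type*} [Fintype ι]

/-- The quadratic form with coefficients `K`. -/
def quadForm (K : ι → ι → ℝ) (c : ι → ℝ) : ℝ := ∑ i, ∑ j, c i * c j * K i j

theorem quadForm_smul (K : ι → ι → ℝ) (a : ℝ) (c : ι → ℝ) :
    quadForm K (a • c) = a ^ 2 * quadForm K c := by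
  simp only [quadForm, Pi.smul_apply, smul_eq_mul, Finset.mul_sum]
  refine Finset.sum_congr rfl fun i _ => Finset.sum_congr rfl fun j _ => by ring

theorem continuous_quadForm :
    Continuous fun p : (ι → ι → ℝ) × (ι → ℝ) => quadForm p.1 p.2 := by
  unfold quadForm
  fun_prop

theorem exists_smul_mem_sphere {c : ι → ℝ} (hc : c ≠ 0) :
    ∃ a : ℝ, 0 < a ∧ ∃ d ∈ sphere (0 : ι → ℝ) 1, c = a • d := by
  have hn : ‖c‖ ≠ 0 := norm_ne_zero_iff.2 hc
  refine ⟨‖c‖, norm_pos_iff.2 hc, ‖c‖⁻¹ • c, ?_, ?_⟩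
  · rw [mem_sphere_zero_iff_norm, norm_smul, norm_inv, norm_norm, inv_mul_cancel₀ hn]
  · rw [smul_smul, mul_inv_cancel₀ hn, one_smul]

theorem exists_quadForm_le {K M : ι → ι → ℝ} (hM : ∀ c, c ≠ 0 → 0 < quadForm M c) :
    ∃ R, ∀ c, quadForm K c ≤ R * quadForm M c := by
  have hcK : Continuous (quadForm K) := continuous_quadForm.comp (Continuous.prodMk_right K)
  have hcM : Continuous (quadForm M) := continuous_quadForm.comp (Continuous.prodMk_right M)
  have hne : ∀ d ∈ sphere (0 : ι → ℝ) 1, d ≠ 0 := fun d hd h => by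
    simp [h] at hd
  have hcont : ContinuousOn (fun c => quadForm K c / quadForm M c) (sphere (0 : ι → ℝ) 1) :=
    hcK.continuousOn.div hcM.continuousOn fun d hd => (hM d (hne d hd)).ne'
  obtain ⟨R, hR⟩ := (isCompact_sphere (0 : ι → ℝ) 1).bddAbove_image hcont
  refine ⟨R, fun c => ?_⟩
  by_cases hc : c = 0
  · subst hc; simp [quadForm]
  · obtain ⟨a, ha, d, hd, rfl⟩ := exists_smul_mem_sphere hc
    have h1 : quadForm K d / quadForm M d ≤ R := hR (mem_image_of_mem _ hd)
    rw [div_le_iff₀ (hM d (hne d hd))] at h1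
    rw [quadForm_smul, quadForm_smul]
    nlinarith [sq_nonneg a]

/-- Stability of generalized eigenvalue bounds under perturbation of the forms. -/
theorem eventually_quadForm_le {K M : ι → ι → ℝ} {Kn Mn : ℕ → ι → ι → ℝ} {r ε : ℝ}
    (hM : ∀ c, c ≠ 0 → 0 < quadForm M c) (hKM : ∀ c, quadForm K c ≤ r * quadForm M c)
    (hε : 0 < ε) (hKn : Tendsto Kn atTop (𝓝 K)) (hMn : Tendsto Mn atTop (𝓝 M)) :
    ∀ᶠ n in atTop, ∀ c, c ≠ 0 →
      0 < quadForm (Mn n) c ∧ quadForm (Kn n) c ≤ (r + ε) * quadForm (Mn n) c := by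
  have hne : ∀ d ∈ sphere (0 : ι → ℝ) 1, d ≠ 0 := fun d hd h => by
    simp [h] at hd
  have hc1 : Continuous fun p : ((ι → ι → ℝ) × (ι → ι → ℝ)) × (ι → ℝ) => quadForm p.1.1 p.2 :=
    continuous_quadForm.comp (f := fun p : ((ι → ι → ℝ) × (ι → ι → ℝ)) × (ι → ℝ) =>
      (p.1.1, p.2)) (by fun_prop)
  have hc2 : Continuous fun p : ((ι → ι → ℝ) × (ι → ι → ℝ)) × (ι → ℝ) => quadForm p.1.2 p.2 :=
    continuous_quadForm.comp (f := fun p : ((ι → ι → ℝ) × (ι → ι → ℝ)) × (ι → ℝ) =>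
      (p.1.2, p.2)) (by fun_prop)
  have hev : ∀ᶠ p : (ι → ι → ℝ) × (ι → ι → ℝ) in 𝓝 (K, M), ∀ d ∈ sphere (0 : ι → ℝ) 1,
      0 < quadForm p.2 d ∧ quadForm p.1 d < (r + ε) * quadForm p.2 d := by
    refine (isCompact_sphere (0 : ι → ℝ) 1).eventually_forall_of_forall_eventually fun d hd => ?_
    have h1 := hM d (hne d hd)
    have h2 : quadForm K d < (r + ε) * quadForm M d := by nlinarith [hKM d]
    exact (hc2.continuousAt.eventually (lt_mem_nhds h1)).and
      (hc1.continuousAt.eventually_lt (continuous_const.mul hc2).continuousAt h2)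
  filter_upwards [(hKn.prodMk_nhds hMn).eventually hev] with n hn c hc
  obtain ⟨a, ha, d, hd, rfl⟩ := exists_smul_mem_sphere hc
  obtain ⟨h1, h2⟩ := hn d hd
  rw [quadForm_smul, quadForm_smul]
  have := pow_pos ha 2
  constructor
  · positivity
  · nlinarith

variable {E H : Type*} [MeasureSpace E] [NormedAddCommGroup H] [InnerProductSpace ℝ H]

theorem integral_norm_sum_smul_sq {F : ι → E → H}
    (hF : ∀ i j, Integrable fun x => inner ℝ (F i x) (F j x)) (c : ι → ℝ) :
    ∫ x, ‖∑ i, c i • F i x‖ ^ 2 = quadForm (fun i j => ∫ x, inner ℝ (F i x) (F j x)) c := by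
  have : ∀ x, ‖∑ i, c i • F i x‖ ^ 2 = ∑ i, ∑ j, c i * c j * inner ℝ (F i x) (F j x) := by
    intro x
    rw [← real_inner_self_eq_norm_sq, sum_inner]
    refine Finset.sum_congr rfl fun i _ => ?_
    rw [inner_sum]
    refine Finset.sum_congr rfl fun j _ => ?_
    rw [real_inner_smul_left, real_inner_smul_right, mul_assoc]
  simp only [this, quadForm]
  rw [integral_finsetSum _ fun i _ => integrable_finsetSum _ fun j _ => (hF i j).const_mul _]
  refine Finset.sum_congr rfl fun i _ => ?_
  rw [integral_finsetSum _ fun j _ => (hF i j).const_mul _]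
  exact Finset.sum_congr rfl fun j _ => integral_const_mul _ _

theorem integrable_inner_of_bounded {f g : E → H} (hf : AEStronglyMeasurable f)
    (hg : AEStronglyMeasurable g) {B : Set E} (hBm : MeasurableSet B) (hB : volume B ≠ ⊤) {C : ℝ}
    (hfC : ∀ x, ‖f x‖ ≤ C) (hgC : ∀ x, ‖g x‖ ≤ C) (hf0 : ∀ x ∉ B, f x = 0) :
    Integrable fun x => inner ℝ (f x) (g x) := by
  have hi : Integrable (B.indicator fun _ => C * C) :=
    (integrable_indicator_iff hBm).2 (integrableOn_const hB)
  refine hi.mono' (hf.inner hg) (Eventually.of_forall fun x => ?_)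
  by_cases hx : x ∈ B
  · rw [indicator_of_mem hx]
    exact (norm_inner_le_norm _ _).trans (mul_le_mul (hfC x) (hgC x) (norm_nonneg _)
      ((norm_nonneg _).trans (hfC x)))
  · simp [indicator_of_notMem hx, hf0 x hx]

theorem tendsto_integral_inner_of_bounded {fn gn : ℕ → E → H} {f g : E → H}
    (hf : ∀ n, AEStronglyMeasurable (fn n)) (hg : ∀ n, AEStronglyMeasurable (gn n))
    {B : Set E} (hBm : MeasurableSet B) (hB : volume B ≠ ⊤) {C : ℝ}
    (hfC : ∀ n x, ‖fn n x‖ ≤ C) (hgC : ∀ n x, ‖gn n x‖ ≤ C) (hf0 : ∀ n, ∀ x ∉ B, fn n x = 0)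
    (hfl : ∀ᵐ x, Tendsto (fun n => fn n x) atTop (𝓝 (f x)))
    (hgl : ∀ᵐ x, Tendsto (fun n => gn n x) atTop (𝓝 (g x))) :
    Tendsto (fun n => ∫ x, inner ℝ (fn n x) (gn n x)) atTop (𝓝 (∫ x, inner ℝ (f x) (g x))) := by
  have hi : Integrable (B.indicator fun _ => C * C) :=
    (integrable_indicator_iff hBm).2 (integrableOn_const hB)
  refine tendsto_integral_of_dominated_convergence _ (fun n => (hf n).inner (hg n)) hi
    (fun n => Eventually.of_forall fun x => ?_) ?_
  · by_cases hx : x ∈ B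
    · rw [indicator_of_mem hx]
      exact (norm_inner_le_norm _ _).trans (mul_le_mul (hfC n x) (hgC n x) (norm_nonneg _)
        ((norm_nonneg _).trans (hfC n x)))
    · simp [indicator_of_notMem hx, hf0 n x hx]
  · filter_upwards [hfl, hgl] with x h1 h2
    exact h1.inner h2

end QuadraticForms

section Rayleigh

open Filter Topology Set Function Metric
open scoped NNReal Gradient

/-- The values of the maximal Rayleigh quotient over `k`-dimensional spaces of test functions. -/
def rayleighValues {n : ℕ} (Ω : Set (EuclideanSpace ℝ (Fin n))) (k : ℕ) : Set ℝ :=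
  { r : ℝ | ∃ E : Submodule ℝ (EuclideanSpace ℝ (Fin n) → ℝ),
    Module.finrank ℝ E = k ∧
    (∀ u ∈ E, ContDiff ℝ (⊤ : ℕ∞) u ∧ HasCompactSupport u ∧ tsupport u ⊆ Ω) ∧
    r = sSup { q : ℝ | ∃ u ∈ E, u ≠ (0 : EuclideanSpace ℝ (Fin n) → ℝ) ∧
        q = (∫ x in Ω, ‖gradient u x‖ ^ 2) / (∫ x in Ω, (u x) ^ 2) } }

theorem dirichletEig_eq_sInf {n : ℕ} (Ω : Set (EuclideanSpace ℝ (Fin n))) (k : ℕ) :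
    dirichletEig Ω k = sInf (rayleighValues Ω k) := rfl

theorem nonneg_of_mem_rayleighValues {n : ℕ} {Ω : Set (EuclideanSpace ℝ (Fin n))} {k : ℕ} {r : ℝ}
    (hr : r ∈ rayleighValues Ω k) : 0 ≤ r := by
  obtain ⟨E, -, -, rfl⟩ := hr
  refine Real.sSup_nonneg ?_
  rintro q ⟨u, -, -, rfl⟩
  positivity

variable {n : ℕ} {Ω : Set (EuclideanSpace ℝ (Fin n))}

theorem gradient_eq_zero_of_notMem_tsupport {u : EuclideanSpace ℝ (Fin n) → ℝ}
    {x : EuclideanSpace ℝ (Fin n)} (hx : x ∉ tsupport u) : ∇ u x = 0 := by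
  rw [gradient, fderiv_of_notMem_tsupport ℝ hx, map_zero]

theorem norm_gradient (u : EuclideanSpace ℝ (Fin n) → ℝ) (x : EuclideanSpace ℝ (Fin n)) :
    ‖∇ u x‖ = ‖fderiv ℝ u x‖ := by
  rw [gradient, LinearIsometryEquiv.norm_map]

theorem aestronglyMeasurable_gradient (u : EuclideanSpace ℝ (Fin n) → ℝ) :
    AEStronglyMeasurable (∇ u) := by
  have : Measurable (∇ u) := by
    unfold gradient
    exact (LinearIsometryEquiv.continuous _).measurable.comp (measurable_fderiv ℝ u)
  exact this.aestronglyMeasurable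

theorem setIntegral_norm_gradient_sq {u : EuclideanSpace ℝ (Fin n) → ℝ} (hu : tsupport u ⊆ Ω) :
    ∫ x in Ω, ‖∇ u x‖ ^ 2 = ∫ x, ‖∇ u x‖ ^ 2 := by
  refine setIntegral_eq_integral_of_forall_compl_eq_zero fun x hx => ?_
  rw [gradient_eq_zero_of_notMem_tsupport fun h => hx (hu h)]
  simp

theorem setIntegral_sq {u : EuclideanSpace ℝ (Fin n) → ℝ} (hu : tsupport u ⊆ Ω) :
    ∫ x in Ω, u x ^ 2 = ∫ x, u x ^ 2 := by
  refine setIntegral_eq_integral_of_forall_compl_eq_zero fun x hx => ?_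
  rw [image_eq_zero_of_notMem_tsupport fun h => hx (hu h)]
  simp

theorem gradient_sum_smul {ι : Type*} [Fintype ι] {u : ι → EuclideanSpace ℝ (Fin n) → ℝ}
    {x : EuclideanSpace ℝ (Fin n)} (hu : ∀ i, DifferentiableAt ℝ (u i) x) (c : ι → ℝ) :
    ∇ (∑ i, c i • u i) x = ∑ i, c i • ∇ (u i) x := by
  simp only [gradient]
  rw [fderiv_sum fun i _ => (hu i).const_smul (c i), map_sum]
  refine Finset.sum_congr rfl fun i _ => ?_
  rw [fderiv_const_smul (hu i), map_smul]

variable {k : ℕ}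

/-- The Gram matrix of a family of functions. -/
noncomputable def massForm (u : Fin k → EuclideanSpace ℝ (Fin n) → ℝ) (i j : Fin k) : ℝ :=
  ∫ x, inner ℝ (u i x) (u j x)

/-- The Gram matrix of the gradients of a family of functions. -/
noncomputable def energyForm (u : Fin k → EuclideanSpace ℝ (Fin n) → ℝ) (i j : Fin k) : ℝ :=
  ∫ x, inner ℝ (∇ (u i) x) (∇ (u j) x)

/-- Lipschitz functions vanishing outside a set. -/
def IsLipschitzZero (Ω : Set (EuclideanSpace ℝ (Fin n))) (v : EuclideanSpace ℝ (Fin n) → ℝ) :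
    Prop :=
  (∃ L : ℝ≥0, LipschitzWith L v) ∧ ∀ x ∉ Ω, v x = 0

theorem isLipschitzZero_of_contDiff {u : EuclideanSpace ℝ (Fin n) → ℝ}
    (h1 : ContDiff ℝ (⊤ : ℕ∞) u) (h2 : HasCompactSupport u) (h3 : tsupport u ⊆ Ω) :
    IsLipschitzZero Ω u :=
  ⟨ContDiff.lipschitzWith_of_hasCompactSupport h2 h1 (by simp),
    fun _ hx => image_eq_zero_of_notMem_tsupport fun h => hx (h3 h)⟩

theorem IsLipschitzZero.exists_bound (hb : Bornology.IsBounded Ω)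
    {v : EuclideanSpace ℝ (Fin n) → ℝ} (hv : IsLipschitzZero Ω v) :
    ∃ C, (∀ x, ‖v x‖ ≤ C) ∧ ∀ x, ‖∇ v x‖ ≤ C := by
  obtain ⟨⟨L, hL⟩, h0⟩ := hv
  have hcs : HasCompactSupport v :=
    HasCompactSupport.intro hb.isCompact_closure fun x hx => h0 x fun h => hx (subset_closure h)
  obtain ⟨C, hC⟩ := hcs.exists_bound_of_continuous hL.continuous
  refine ⟨max C L, fun x => (hC x).trans (le_max_left _ _), fun x => ?_⟩
  rw [norm_gradient]
  exact (norm_fderiv_le_of_lipschitz ℝ hL).trans (le_max_right _ _)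

theorem IsLipschitzZero.tsupport_subset {v : EuclideanSpace ℝ (Fin n) → ℝ}
    (hv : IsLipschitzZero Ω v) : tsupport v ⊆ closure Ω :=
  closure_mono fun x hx => by
    by_contra h
    exact hx (hv.2 x h)

theorem IsLipschitzZero.integrable_inner (hb : Bornology.IsBounded Ω)
    {u v : EuclideanSpace ℝ (Fin n) → ℝ} (hu : IsLipschitzZero Ω u) (hv : IsLipschitzZero Ω v) :
    (Integrable fun x => inner ℝ (u x) (v x)) ∧ Integrable fun x => inner ℝ (∇ u x) (∇ v x) := by
  obtain ⟨C, hC1, hC2⟩ := hu.exists_bound hb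
  obtain ⟨C', hC1', hC2'⟩ := hv.exists_bound hb
  have hm : volume (closure Ω) ≠ ⊤ := hb.isCompact_closure.measure_lt_top.ne
  obtain ⟨L, hL⟩ := hu.1
  obtain ⟨L', hL'⟩ := hv.1
  constructor
  · exact integrable_inner_of_bounded hL.continuous.aestronglyMeasurable
      hL'.continuous.aestronglyMeasurable isClosed_closure.measurableSet hm
      (fun x => (hC1 x).trans (le_max_left C C')) (fun x => (hC1' x).trans (le_max_right C C'))
      fun x hx => hu.2 x fun h => hx (subset_closure h)
  · exact integrable_inner_of_bounded (aestronglyMeasurable_gradient u)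
      (aestronglyMeasurable_gradient v) isClosed_closure.measurableSet hm
      (fun x => (hC2 x).trans (le_max_left C C')) (fun x => (hC2' x).trans (le_max_right C C'))
      fun x hx => gradient_eq_zero_of_notMem_tsupport fun h => hx (hu.tsupport_subset h)

theorem quadForm_massForm (hb : Bornology.IsBounded Ω)
    {u : Fin k → EuclideanSpace ℝ (Fin n) → ℝ} (hu : ∀ i, IsLipschitzZero Ω (u i))
    (c : Fin k → ℝ) : quadForm (massForm u) c = ∫ x, (∑ i, c i • u i) x ^ 2 := by
  refine (integral_norm_sum_smul_sq (F := u)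
    (fun i j => ((hu i).integrable_inner hb (hu j)).1) c).symm.trans ?_
  simp

theorem quadForm_energyForm (hb : Bornology.IsBounded Ω)
    {u : Fin k → EuclideanSpace ℝ (Fin n) → ℝ} (hu : ∀ i, IsLipschitzZero Ω (u i))
    (c : Fin k → ℝ) : quadForm (energyForm u) c = ∫ x, ‖∇ (∑ i, c i • u i) x‖ ^ 2 := by
  refine (integral_norm_sum_smul_sq (F := fun i => ∇ (u i))
    (fun i j => ((hu i).integrable_inner hb (hu j)).2) c).symm.trans ?_
  refine integral_congr_ae ?_
  have : ∀ᵐ x, ∀ i, DifferentiableAt ℝ (u i) x := by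
    rw [ae_all_iff]
    intro i
    obtain ⟨L, hL⟩ := (hu i).1
    exact hL.ae_differentiableAt
  filter_upwards [this] with x hx
  rw [gradient_sum_smul hx]

/-- Linearly independent test functions with bounded Rayleigh quotients. -/
theorem exists_basis_of_mem_rayleighValues (hb : Bornology.IsBounded Ω) (hk : 1 ≤ k) {r : ℝ}
    (hr : r ∈ rayleighValues Ω k) :
    ∃ u : Fin k → EuclideanSpace ℝ (Fin n) → ℝ,
      (∀ i, ContDiff ℝ (⊤ : ℕ∞) (u i) ∧ HasCompactSupport (u i) ∧ tsupport (u i) ⊆ Ω) ∧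
      (∀ c, c ≠ 0 → 0 < quadForm (massForm u) c) ∧
      ∀ c, quadForm (energyForm u) c ≤ r * quadForm (massForm u) c := by
  obtain ⟨E, hE, hsm, hr⟩ := hr
  have : FiniteDimensional ℝ E := Module.finite_of_finrank_pos (by omega)
  let b := Module.finBasisOfFinrankEq ℝ E hE
  set u : Fin k → EuclideanSpace ℝ (Fin n) → ℝ := fun i => (b i : EuclideanSpace ℝ (Fin n) → ℝ)
    with hu
  have hus := fun i => hsm (u i) (b i).2
  have hlz : ∀ i, IsLipschitzZero Ω (u i) := fun i =>
    isLipschitzZero_of_contDiff (hus i).1 (hus i).2.1 (hus i).2.2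
  have hmem : ∀ c : Fin k → ℝ, ∑ i, c i • u i ∈ E := fun c =>
    E.sum_mem fun i _ => E.smul_mem _ (b i).2
  have hne : ∀ c : Fin k → ℝ, c ≠ 0 → ∑ i, c i • u i ≠ 0 := fun c hc h => by
    refine hc (funext fun i => ?_)
    have h2 : ∑ i, c i • b i = 0 := by
      apply Subtype.ext
      simpa [hu] using h
    exact Fintype.linearIndependent_iff.1 b.linearIndependent c h2 i
  have hpos : ∀ c, c ≠ 0 → 0 < quadForm (massForm u) c := fun c hc => by
    rw [quadForm_massForm hb hlz]
    obtain ⟨h1, h2, h3⟩ := hsm _ (hmem c)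
    obtain ⟨x, hx⟩ := Function.ne_iff.1 (hne c hc)
    refine (h1.continuous.pow 2).integral_pos_of_hasCompactSupport_nonneg_nonzero (x := x)
      ?_ (fun y => sq_nonneg _) (pow_ne_zero 2 hx)
    exact h2.comp_left (g := fun t : ℝ => t ^ 2) (by simp)
  have hquot : ∀ c : Fin k → ℝ, (∫ x in Ω, ‖∇ (∑ i, c i • u i) x‖ ^ 2) /
      (∫ x in Ω, (∑ i, c i • u i) x ^ 2) =
      quadForm (energyForm u) c / quadForm (massForm u) c := fun c => by
    obtain ⟨h1, h2, h3⟩ := hsm _ (hmem c)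
    rw [quadForm_massForm hb hlz, quadForm_energyForm hb hlz, setIntegral_norm_gradient_sq h3,
      setIntegral_sq h3]
  have hbdd : BddAbove { q : ℝ | ∃ u ∈ E, u ≠ (0 : EuclideanSpace ℝ (Fin n) → ℝ) ∧
        q = (∫ x in Ω, ‖∇ u x‖ ^ 2) / (∫ x in Ω, (u x) ^ 2) } := by
    obtain ⟨R, hR⟩ := exists_quadForm_le (K := energyForm u) hpos
    refine ⟨R, ?_⟩
    rintro q ⟨f, hf, hf0, rfl⟩
    have hfe : f = ∑ i, b.repr ⟨f, hf⟩ i • u i := by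
      have h := congrArg (Submodule.subtype E) (b.sum_repr ⟨f, hf⟩)
      rw [map_sum] at h
      exact h.symm
    have hc : (b.repr ⟨f, hf⟩ : Fin k → ℝ) ≠ 0 := fun h => by
      rw [hfe] at hf0
      simp [h] at hf0
    rw [hfe, hquot, div_le_iff₀ (hpos _ hc)]
    exact hR _
  refine ⟨u, hus, hpos, fun c => ?_⟩
  by_cases hc : c = 0
  · subst hc; simp [quadForm]
  · rw [← div_le_iff₀ (hpos c hc), ← hquot c, hr]
    exact le_csSup hbdd ⟨_, hmem c, hne c hc, rfl⟩

/-- Linearly independent Lipschitz functions with Rayleigh quotients at most `r` can be replaced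
by test functions with Rayleigh quotients at most `r + ε`. -/
theorem exists_mem_rayleighValues_le (hb : Bornology.IsBounded Ω)
    {v : Fin k → EuclideanSpace ℝ (Fin n) → ℝ} (hv : ∀ i, IsLipschitzZero Ω (v i)) {r ε : ℝ}
    (hr : 0 ≤ r) (hε : 0 < ε) (hpos : ∀ c, c ≠ 0 → 0 < quadForm (massForm v) c)
    (hle : ∀ c, quadForm (energyForm v) c ≤ r * quadForm (massForm v) c) :
    ∃ r' ∈ rayleighValues Ω k, r' ≤ r + ε := by
  choose L hL using fun i => (hv i).1
  choose w hw hC hwl hwg using fun i => (hL i).exists_smooth_approx hb (hv i).2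
  choose C hC using hC
  have hwz : ∀ i m, IsLipschitzZero Ω (w i m) := fun i m =>
    isLipschitzZero_of_contDiff (hw i m).1 (hw i m).2.1 (hw i m).2.2.1
  obtain ⟨D, hD1, hD2⟩ : ∃ D, (∀ i, C i ≤ D) ∧ ∀ i, (L i : ℝ) ≤ D := by
    refine ⟨∑ i, (|C i| + L i), fun i => ?_, fun i => ?_⟩
    · refine le_trans ?_ (Finset.single_le_sum (f := fun i => |C i| + (L i : ℝ))
        (fun j _ => by positivity) (Finset.mem_univ i))
      have := le_abs_self (C i)
      have := (L i).coe_nonneg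
      linarith
    · refine le_trans ?_ (Finset.single_le_sum (f := fun i => |C i| + (L i : ℝ))
        (fun j _ => by positivity) (Finset.mem_univ i))
      have := abs_nonneg (C i)
      linarith
  have hm : volume (closure Ω) ≠ ⊤ := hb.isCompact_closure.measure_lt_top.ne
  have hmass : Tendsto (fun m => massForm fun i => w i m) atTop (𝓝 (massForm v)) := by
    rw [tendsto_pi_nhds]; intro i
    rw [tendsto_pi_nhds]; intro j
    exact tendsto_integral_inner_of_bounded (C := D)
      (fun m => (hw i m).1.continuous.aestronglyMeasurable)
      (fun m => (hw j m).1.continuous.aestronglyMeasurable)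
      isClosed_closure.measurableSet hm
      (fun m x => (hC i m x).trans (hD1 i)) (fun m x => (hC j m x).trans (hD1 j))
      (fun m x hx => (hwz i m).2 x fun h => hx (subset_closure h))
      (Eventually.of_forall (hwl i)) (Eventually.of_forall (hwl j))
  have hglim : ∀ i, ∀ᵐ x, Tendsto (fun m => ∇ (w i m) x) atTop (𝓝 (∇ (v i) x)) := fun i => by
    filter_upwards [hwg i] with x hx
    exact ((LinearIsometryEquiv.continuous _).tendsto _).comp hx
  have hgb : ∀ i m x, ‖∇ (w i m) x‖ ≤ D := fun i m x => by
    rw [norm_gradient]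
    exact (norm_fderiv_le_of_lipschitz ℝ (hw i m).2.2.2).trans (hD2 i)
  have henergy : Tendsto (fun m => energyForm fun i => w i m) atTop (𝓝 (energyForm v)) := by
    rw [tendsto_pi_nhds]; intro i
    rw [tendsto_pi_nhds]; intro j
    exact tendsto_integral_inner_of_bounded (C := D)
      (fun m => aestronglyMeasurable_gradient _) (fun m => aestronglyMeasurable_gradient _)
      isClosed_closure.measurableSet hm (hgb i) (hgb j)
      (fun m x hx => gradient_eq_zero_of_notMem_tsupport fun h =>
        hx ((hwz i m).tsupport_subset h))
      (hglim i) (hglim j)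
  obtain ⟨m, hmq⟩ := (eventually_quadForm_le hpos hle hε henergy hmass).exists
  set u : Fin k → EuclideanSpace ℝ (Fin n) → ℝ := fun i => w i m with hu
  have hlz : ∀ i, IsLipschitzZero Ω (u i) := fun i => hwz i m
  have hli : LinearIndependent ℝ u := by
    rw [Fintype.linearIndependent_iff]
    intro c hc
    by_contra! h
    obtain ⟨i, hi⟩ := h
    have h1 := (hmq c fun h => hi (congrFun h i)).1
    rw [quadForm_massForm hb hlz, hc] at h1
    simp at h1
  have hsmooth : ∀ f ∈ Submodule.span ℝ (range u),
      ContDiff ℝ (⊤ : ℕ∞) f ∧ HasCompactSupport f ∧ tsupport f ⊆ Ω := by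
    intro f hf
    induction hf using Submodule.span_induction with
    | mem x hx =>
      obtain ⟨i, rfl⟩ := hx
      exact ⟨(hw i m).1, (hw i m).2.1, (hw i m).2.2.1⟩
    | zero => 
      refine ⟨contDiff_const (c := (0 : ℝ)), HasCompactSupport.zero, ?_⟩
      simp [tsupport]
    | add x y _ _ hx hy =>
      exact ⟨hx.1.add hy.1, hx.2.1.add hy.2.1,
        (tsupport_add x y).trans (union_subset hx.2.2 hy.2.2)⟩
    | smul a x _ hx =>
      exact ⟨contDiff_const.smul hx.1, hx.2.1.smul_left (f := fun _ => a),
        (tsupport_smul_subset_right (fun _ => a) x).trans hx.2.2⟩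
  refine ⟨_, ⟨Submodule.span ℝ (range u), ?_, hsmooth, rfl⟩, ?_⟩
  · rw [finrank_span_eq_card hli, Fintype.card_fin]
  · refine Real.sSup_le ?_ (by positivity)
    rintro q ⟨f, hf, hf0, rfl⟩
    obtain ⟨-, -, h3⟩ := hsmooth f hf
    obtain ⟨c, rfl⟩ := (Submodule.mem_span_range_iff_exists_fun ℝ).1 hf
    have hc : c ≠ 0 := fun h => by simp [h] at hf0
    rw [setIntegral_norm_gradient_sq h3, setIntegral_sq h3, ← quadForm_massForm hb hlz,
      ← quadForm_energyForm hb hlz, div_le_iff₀ (hmq c hc).1]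
    exact (hmq c hc).2

/-- If the Rayleigh values of each of two sets can be approximated from above by those of the
other, the eigenvalues agree. -/
theorem sInf_le_sInf_of_forall_exists_le {S T : Set ℝ} (hT : ∀ t ∈ T, 0 ≤ t) (hS : S.Nonempty)
    (h : ∀ s ∈ S, ∀ ε > 0, ∃ t ∈ T, t ≤ s + ε) : sInf T ≤ sInf S := by
  refine le_csInf hS fun s hs => le_of_forall_pos_le_add fun ε hε => ?_
  obtain ⟨t, ht, hts⟩ := h s hs ε hε
  exact (csInf_le ⟨0, hT⟩ ht).trans hts

end Rayleigh

section PiecewiseLipschitz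

open Set Function Metric
open scoped NNReal

theorem abs_sub_le_of_lipschitzOn_closed_cover {ι : Type*} [DecidableEq ι] {g : ℝ → ℝ} {K : ℝ}
    {G : ι → Set ℝ} (hG : ∀ i, IsClosed (G i))
    (hg : ∀ i, ∀ a ∈ G i, ∀ b ∈ G i, |g b - g a| ≤ K * |b - a|) (s : Finset ι) :
    ∀ a b, a ≤ b → (∀ t ∈ Icc a b, ∃ i ∈ s, t ∈ G i) → |g b - g a| ≤ K * (b - a) := by
  induction s using Finset.strongInduction with
  | H s ih =>
    intro a b hab hcov
    obtain ⟨i, hi, hai⟩ := hcov a (left_mem_Icc.2 hab)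
    have hcomp : IsCompact (Icc a b ∩ G i) := isCompact_Icc.inter_right (hG i)
    obtain ⟨c, ⟨hc, hci⟩, hmax⟩ := hcomp.exists_isGreatest ⟨a, left_mem_Icc.2 hab, hai⟩
    have h1 := hg i a hai c hci
    rw [abs_of_nonneg (sub_nonneg.2 hc.1)] at h1
    rcases eq_or_lt_of_le hc.2 with hcb | hcb
    · rwa [← hcb]
    have hclosed : IsClosed (⋃ j ∈ s.erase i, G j) :=
      isClosed_biUnion_finset fun j _ => hG j
    have hsub : Ioc c b ⊆ ⋃ j ∈ s.erase i, G j := fun t ht => by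
      obtain ⟨j, hj, htj⟩ := hcov t ⟨hc.1.trans ht.1.le, ht.2⟩
      refine mem_biUnion (Finset.mem_coe.2 (Finset.mem_erase.2 ⟨?_, hj⟩)) htj
      rintro rfl
      exact absurd (hmax ⟨⟨hc.1.trans ht.1.le, ht.2⟩, htj⟩) (not_le.2 ht.1)
    have hsub' : Icc c b ⊆ ⋃ j ∈ s.erase i, G j := by
      rw [← closure_Ioc hcb.ne]
      exact closure_minimal hsub hclosed
    have h2 := ih (s.erase i) (Finset.erase_ssubset hi) c b hcb.le fun t ht => by
      simpa only [mem_iUnion, exists_prop] using hsub' ht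
    have h3 := abs_sub_le (g b) (g c) (g a)
    linarith

/-- A function which is Lipschitz on each member of a finite closed cover of a normed space is
Lipschitz. -/
theorem lipschitzWith_of_closed_cover {E : Type*} [NormedAddCommGroup E] [NormedSpace ℝ E]
    {ι : Type*} [Fintype ι] {f : E → ℝ} {K : ℝ≥0} {F : ι → Set E} (hF : ∀ i, IsClosed (F i))
    (hcov : ∀ x, ∃ i, x ∈ F i) (hf : ∀ i, LipschitzOnWith K f (F i)) : LipschitzWith K f := by
  classical
  refine LipschitzWith.of_dist_le_mul fun x y => ?_
  set γ : ℝ → E := fun t => AffineMap.lineMap y x t with hγ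
  have hγc : Continuous γ := AffineMap.lineMap_continuous
  have h := abs_sub_le_of_lipschitzOn_closed_cover (g := f ∘ γ) (K := K * dist x y)
    (G := fun i => γ ⁻¹' F i) (fun i => (hF i).preimage hγc)
    (fun i a ha b hb => by
      have h1 := (hf i).dist_le_mul _ hb _ ha
      have h2 : dist (γ b) (γ a) = dist b a * dist y x := dist_lineMap_lineMap y x b a
      rw [h2, Real.dist_eq, Real.dist_eq, dist_comm y x] at h1
      simp only [Function.comp]
      linarith) Finset.univ 0 1 zero_le_one
    (fun t _ => by
      obtain ⟨i, hi⟩ := hcov (γ t)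
      exact ⟨i, Finset.mem_univ i, hi⟩)
  simpa [hγ, Real.dist_eq] using h

end PiecewiseLipschitz

section Transplantation

open Filter Topology Set Function Metric
open scoped NNReal Gradient

variable {n : ℕ} {ι κ : Type*} [Fintype ι]

/-- An open set `Ω` tiled by isometric copies `φ i '' D` of a tile `D` with sides `S s`, where
`g s i` is the tile glued to the tile `i` along the side `s`, and `g s i = i` if that side lies on
the boundary of `Ω`. -/
structure IsGluedTiling (Ω D : Set (EuclideanSpace ℝ (Fin n)))
    (S : κ → Set (EuclideanSpace ℝ (Fin n))) (g : κ → ι → ι)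
    (φ : ι → EuclideanSpace ℝ (Fin n) ≃ᵃⁱ[ℝ] EuclideanSpace ℝ (Fin n)) : Prop where
  bounded : Bornology.IsBounded Ω
  subset : Ω ⊆ ⋃ i, φ i '' D
  disjoint : Pairwise (Disjoint on fun i => φ i '' interior D)
  glue : ∀ s i, ∀ p ∈ S s, φ (g s i) p = φ i p
  boundary : ∀ s i, ∀ p ∈ S s, g s i = i → φ i p ∉ Ω
  vertex : ∀ s t i p, s ≠ t → p ∈ S s → p ∈ S t → φ i p ∉ Ω
  meet : ∀ i j, ∀ p ∈ D, ∀ q ∈ D, φ i p = φ j q → p = q ∧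
    (i = j ∨ (∃ s, p ∈ S s ∧ g s i = j) ∨ ∃ s t, s ≠ t ∧ p ∈ S s ∧ p ∈ S t)
  exit : ∀ i, ∀ p ∈ D, φ i p ∉ Ω → ∃ s, p ∈ S s ∧ (g s i = i ∨ ∃ t, s ≠ t ∧ p ∈ S t)

/-- The sign `-1` on boundary sides, and `1` on glued sides. -/
noncomputable def boundarySign [DecidableEq ι] (g : κ → ι → ι) (s : κ) (i : ι) : ℝ :=
  if g s i = i then -1 else 1

/-- An orthogonal matrix intertwining two gluing patterns. -/
structure IsTransplantation [DecidableEq ι] (gA gB : κ → ι → ι) (T : ι → ι → ℝ) : Prop where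
  orthogonal : ∀ i i', ∑ j, T j i * T j i' = if i = i' then 1 else 0
  intertwine : ∀ s j i, T (gB s j) i = boundarySign gB s j * boundarySign gA s i * T j (gA s i)

/-- The superposition of the restrictions of `u` to the tiles `φ i`, with weights from the `j`-th
row of `T`. -/
noncomputable def superpose (T : ι → ι → ℝ)
    (φ : ι → EuclideanSpace ℝ (Fin n) ≃ᵃⁱ[ℝ] EuclideanSpace ℝ (Fin n))
    (u : EuclideanSpace ℝ (Fin n) → ℝ) (j : ι) : EuclideanSpace ℝ (Fin n) → ℝ :=
  ∑ i, T j i • (u ∘ φ i)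

open Classical in
/-- The transplant of `u` to a set tiled by the `ψ j '' D`. -/
noncomputable def transplant (D : Set (EuclideanSpace ℝ (Fin n))) (T : ι → ι → ℝ)
    (φ ψ : ι → EuclideanSpace ℝ (Fin n) ≃ᵃⁱ[ℝ] EuclideanSpace ℝ (Fin n))
    (u : EuclideanSpace ℝ (Fin n) → ℝ) (x : EuclideanSpace ℝ (Fin n)) : ℝ :=
  if h : ∃ q : ι × EuclideanSpace ℝ (Fin n), q.2 ∈ D ∧ ψ q.1 q.2 = x then
    superpose T φ u h.choose.1 h.choose.2 else 0

variable {ΩA ΩB D : Set (EuclideanSpace ℝ (Fin n))} {S : κ → Set (EuclideanSpace ℝ (Fin n))}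
  {gA gB : κ → ι → ι} {φ ψ : ι → EuclideanSpace ℝ (Fin n) ≃ᵃⁱ[ℝ] EuclideanSpace ℝ (Fin n)}
  {T : ι → ι → ℝ}

theorem superpose_apply (u : EuclideanSpace ℝ (Fin n) → ℝ) (j : ι)
    (p : EuclideanSpace ℝ (Fin n)) : superpose T φ u j p = ∑ i, T j i * u (φ i p) := by
  simp [superpose]

theorem IsGluedTiling.superpose_vertex (hA : IsGluedTiling ΩA D S gA φ)
    {u : EuclideanSpace ℝ (Fin n) → ℝ} (hu : ∀ x ∉ ΩA, u x = 0) {s t : κ} (hst : s ≠ t) (j : ι)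
    {p : EuclideanSpace ℝ (Fin n)} (hs : p ∈ S s) (ht : p ∈ S t) :
    superpose T φ u j p = 0 := by
  rw [superpose_apply]
  exact Finset.sum_eq_zero fun i _ => by rw [hu _ (hA.vertex s t i p hst hs ht), mul_zero]

theorem transplant_sum_smul {k : ℕ} (u : Fin k → EuclideanSpace ℝ (Fin n) → ℝ) (c : Fin k → ℝ) :
    transplant D T φ ψ (∑ l, c l • u l) = ∑ l, c l • transplant D T φ ψ (u l) := by
  ext x
  rw [Finset.sum_apply]
  simp only [Pi.smul_apply, smul_eq_mul, transplant]
  split_ifs with h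
  · simp only [superpose_apply, Finset.sum_apply, Pi.smul_apply, smul_eq_mul, Finset.mul_sum]
    rw [Finset.sum_comm]
    refine Finset.sum_congr rfl fun l _ => Finset.sum_congr rfl fun i _ => by ring
  · simp

theorem lipschitzWith_superpose {u : EuclideanSpace ℝ (Fin n) → ℝ} {L : ℝ≥0}
    (hu : LipschitzWith L u) (j : ι) : LipschitzWith (∑ i, ‖T j i‖₊ * L) (superpose T φ u j) := by
  unfold superpose
  refine LipschitzWith.of_dist_le_mul fun x y => ?_
  push_cast
  rw [Finset.sum_mul, Real.dist_eq, Finset.sum_apply, Finset.sum_apply, ← Finset.sum_sub_distrib]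
  refine (Finset.abs_sum_le_sum_abs _ _).trans (Finset.sum_le_sum fun i _ => ?_)
  have h := hu.dist_le_mul (φ i x) (φ i y)
  rw [(φ i).dist_map, Real.dist_eq] at h
  simp only [Pi.smul_apply, smul_eq_mul, Function.comp, ← mul_sub, abs_mul, Real.norm_eq_abs, mul_assoc]
  gcongr

theorem AffineIsometryEquiv.measurePreserving_euclideanSpace
    (e : EuclideanSpace ℝ (Fin n) ≃ᵃⁱ[ℝ] EuclideanSpace ℝ (Fin n)) :
    MeasurePreserving e volume volume := by
  have h1 : (e : EuclideanSpace ℝ (Fin n) → EuclideanSpace ℝ (Fin n)) =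
      (fun x => x + e 0) ∘ e.linearIsometryEquiv := by
    ext1 x
    have := e.map_vadd 0 x
    simpa using this
  rw [h1]
  exact (measurePreserving_add_right volume (e 0)).comp
    e.linearIsometryEquiv.measurePreserving

/-- The integral over a tiled set of a function vanishing outside of it. -/
theorem IsGluedTiling.integral_eq_sum (hB : IsGluedTiling ΩB D S gB ψ) (hDc : Convex ℝ D)
    (hD : IsCompact D) {f : EuclideanSpace ℝ (Fin n) → ℝ} (hf : Integrable f)
    (hf0 : ∀ᵐ x, x ∉ ΩB → f x = 0) : ∫ x, f x = ∑ j, ∫ p in interior D, f (ψ j p) := by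
  have hemb : ∀ j, MeasurableEmbedding (ψ j) := fun j =>
    (ψ j).toHomeomorph.measurableEmbedding
  have hmeas : ∀ j, MeasurableSet (ψ j '' interior D) := fun j =>
    (hemb j).measurableSet_image.2 isOpen_interior.measurableSet
  have hnull : ∀ᵐ x, ∀ j, x ∉ ψ j '' frontier D := by
    rw [ae_all_iff]
    intro j
    have h1 : volume (ψ j '' frontier D) = 0 := by
      rw [← (ψ j).measurePreserving_euclideanSpace.measure_preimage_emb (hemb j),
        preimage_image_eq _ (ψ j).injective]
      exact hDc.addHaar_frontier volume
    exact measure_eq_zero_iff_ae_notMem.1 h1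
  have h1 : ∫ x, f x = ∫ x in ⋃ j, ψ j '' interior D, f x := by
    refine (setIntegral_eq_integral_of_ae_compl_eq_zero ?_).symm
    filter_upwards [hnull, hf0] with x hx hx0 hxU
    refine hx0 fun hΩ => ?_
    obtain ⟨j, p, hp, rfl⟩ := mem_iUnion.1 (hB.subset hΩ)
    have hpi : p ∉ interior D := fun h => hxU (mem_iUnion.2 ⟨j, p, h, rfl⟩)
    refine hx j ⟨p, ?_, rfl⟩
    rw [hD.isClosed.frontier_eq]
    exact ⟨hp, hpi⟩
  rw [h1, integral_iUnion_fintype hmeas hB.disjoint fun j => hf.integrableOn]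
  refine Finset.sum_congr rfl fun j _ => ?_
  exact (ψ j).measurePreserving_euclideanSpace.setIntegral_image_emb (hemb j) f _

variable [DecidableEq ι]

theorem IsGluedTiling.superpose_glue (hA : IsGluedTiling ΩA D S gA φ)
    (hinv : ∀ s, Involutive (gA s)) (hT : IsTransplantation gA gB T)
    {u : EuclideanSpace ℝ (Fin n) → ℝ} (hu : ∀ x ∉ ΩA, u x = 0) {s : κ} {j : ι}
    {p : EuclideanSpace ℝ (Fin n)} (hp : p ∈ S s) :
    superpose T φ u (gB s j) p = boundarySign gB s j * superpose T φ u j p := by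
  rw [superpose_apply, superpose_apply, ← Equiv.sum_comp (hinv s).toPerm fun i =>
    T j i * u (φ i p), Finset.mul_sum]
  refine Finset.sum_congr rfl fun i _ => ?_
  have h : boundarySign gA s i * u (φ i p) = u (φ (gA s i) p) := by
    rw [hA.glue s i p hp]
    by_cases hb : gA s i = i
    · rw [hu _ (hA.boundary s i p hp hb), mul_zero]
    · simp [boundarySign, hb]
  rw [hT.intertwine s j i, Involutive.coe_toPerm, ← h]
  ring

theorem transplant_apply (hA : IsGluedTiling ΩA D S gA φ) (hB : IsGluedTiling ΩB D S gB ψ)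
    (hinv : ∀ s, Involutive (gA s)) (hT : IsTransplantation gA gB T)
    {u : EuclideanSpace ℝ (Fin n) → ℝ} (hu : ∀ x ∉ ΩA, u x = 0) (j : ι)
    {p : EuclideanSpace ℝ (Fin n)} (hp : p ∈ D) :
    transplant D T φ ψ u (ψ j p) = superpose T φ u j p := by
  have h : ∃ q : ι × EuclideanSpace ℝ (Fin n), q.2 ∈ D ∧ ψ q.1 q.2 = ψ j p := ⟨(j, p), hp, rfl⟩
  rw [transplant, dif_pos h]
  obtain ⟨h1, h2⟩ := h.choose_spec
  generalize h.choose = q at h1 h2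
  obtain ⟨i, q⟩ := q
  obtain ⟨rfl, rfl | ⟨s, hs, rfl⟩ | ⟨s, t, hst, hs, ht⟩⟩ := hB.meet i j q h1 p hp h2
  · rfl
  · rw [hA.superpose_glue hinv hT hu hs, boundarySign]
    split_ifs with hfix
    · have h3 := hA.superpose_glue hinv hT hu hs (j := i)
      rw [hfix, boundarySign, if_pos hfix] at h3
      exact h3
    · rw [one_mul]
  · rw [hA.superpose_vertex hu hst _ hs ht, hA.superpose_vertex hu hst _ hs ht]

theorem transplant_eq_zero (hA : IsGluedTiling ΩA D S gA φ) (hB : IsGluedTiling ΩB D S gB ψ)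
    (hinv : ∀ s, Involutive (gA s)) (hT : IsTransplantation gA gB T)
    {u : EuclideanSpace ℝ (Fin n) → ℝ} (hu : ∀ x ∉ ΩA, u x = 0)
    {x : EuclideanSpace ℝ (Fin n)} (hx : x ∉ ΩB) :
    transplant D T φ ψ u x = 0 := by
  by_cases h : ∃ q : ι × EuclideanSpace ℝ (Fin n), q.2 ∈ D ∧ ψ q.1 q.2 = x
  · obtain ⟨⟨i, p⟩, hp, rfl⟩ := h
    rw [transplant_apply hA hB hinv hT hu i hp]
    obtain ⟨s, hs, hfix | ⟨t, hst, ht⟩⟩ := hB.exit i p hp hx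
    · have h3 := hA.superpose_glue hinv hT hu hs (j := i)
      rw [hfix, boundarySign, if_pos hfix] at h3
      simp only at h3 ⊢
      linarith
    · exact hA.superpose_vertex hu hst _ hs ht
  · rw [transplant, dif_neg h]

theorem isLipschitzZero_transplant (hD : IsCompact D) (hΩB : IsOpen ΩB)
    (hA : IsGluedTiling ΩA D S gA φ) (hB : IsGluedTiling ΩB D S gB ψ)
    (hinv : ∀ s, Involutive (gA s)) (hT : IsTransplantation gA gB T)
    {u : EuclideanSpace ℝ (Fin n) → ℝ} (hu : IsLipschitzZero ΩA u) :
    IsLipschitzZero ΩB (transplant D T φ ψ u) := by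
  obtain ⟨⟨L, hL⟩, h0⟩ := hu
  refine ⟨⟨∑ j, ∑ i, ‖T j i‖₊ * L, ?_⟩, fun x hx => transplant_eq_zero hA hB hinv hT h0 hx⟩
  refine lipschitzWith_of_closed_cover (ι := Option ι)
    (F := fun o => o.elim ΩBᶜ fun j => ψ j '' D) ?_ ?_ ?_
  · rintro (_ | j)
    · exact hΩB.isClosed_compl
    · exact (hD.image (ψ j).continuous).isClosed
  · intro x
    by_cases hx : x ∈ ΩB
    · obtain ⟨j, hj⟩ := mem_iUnion.1 (hB.subset hx)
      exact ⟨some j, hj⟩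
    · exact ⟨none, hx⟩
  · rintro (_ | j)
    · refine LipschitzOnWith.of_dist_le_mul fun x hx y hy => ?_
      rw [transplant_eq_zero hA hB hinv hT h0 hx, transplant_eq_zero hA hB hinv hT h0 hy, dist_self]
      positivity
    · refine LipschitzOnWith.of_dist_le_mul ?_
      rintro _ ⟨p, hp, rfl⟩ _ ⟨q, hq, rfl⟩
      rw [transplant_apply hA hB hinv hT h0 j hp, transplant_apply hA hB hinv hT h0 j hq,
        (ψ j).dist_map]
      refine ((lipschitzWith_superpose hL j).dist_le_mul p q).trans ?_
      refine mul_le_mul_of_nonneg_right (NNReal.coe_le_coe.2 ?_) dist_nonneg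
      exact Finset.single_le_sum (f := fun j => ∑ i, ‖T j i‖₊ * L) (fun _ _ => zero_le)
        (Finset.mem_univ j)

theorem AffineIsometryEquiv.hasFDerivAt_euclideanSpace
    (e : EuclideanSpace ℝ (Fin n) ≃ᵃⁱ[ℝ] EuclideanSpace ℝ (Fin n)) {p : EuclideanSpace ℝ (Fin n)} :
    HasFDerivAt e (e.linearIsometryEquiv.toContinuousLinearEquiv :
      EuclideanSpace ℝ (Fin n) →L[ℝ] EuclideanSpace ℝ (Fin n)) p := by
  have h1 : (e : EuclideanSpace ℝ (Fin n) → EuclideanSpace ℝ (Fin n)) =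
      fun x => e.linearIsometryEquiv x + e 0 := by
    ext1 x
    have := e.map_vadd 0 x
    simpa using this
  rw [h1]
  exact (e.linearIsometryEquiv.toContinuousLinearEquiv.hasFDerivAt).add_const _

theorem norm_gradient_comp_affineIsometryEquiv {f : EuclideanSpace ℝ (Fin n) → ℝ}
    (e : EuclideanSpace ℝ (Fin n) ≃ᵃⁱ[ℝ] EuclideanSpace ℝ (Fin n)) {p : EuclideanSpace ℝ (Fin n)}
    (hf : DifferentiableAt ℝ f (e p)) : ‖∇ (f ∘ e) p‖ = ‖∇ f (e p)‖ := by
  rw [norm_gradient, norm_gradient, (hf.hasFDerivAt.comp p e.hasFDerivAt_euclideanSpace).fderiv]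
  exact ContinuousLinearMap.opNorm_comp_linearIsometryEquiv _ _

theorem IsTransplantation.sum_norm_sq (hT : IsTransplantation gA gB T) {H : Type*}
    [NormedAddCommGroup H] [InnerProductSpace ℝ H] (h : ι → H) :
    ∑ j, ‖∑ i, T j i • h i‖ ^ 2 = ∑ i, ‖h i‖ ^ 2 := by
  have h1 : ∀ j, ‖∑ i, T j i • h i‖ ^ 2 = ∑ i, ∑ i', T j i * T j i' * inner ℝ (h i) (h i') := by
    intro j
    rw [← real_inner_self_eq_norm_sq, sum_inner]
    refine Finset.sum_congr rfl fun i _ => ?_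
    rw [inner_sum]
    refine Finset.sum_congr rfl fun i' _ => ?_
    rw [real_inner_smul_left, real_inner_smul_right, mul_assoc]
  simp only [h1]
  rw [Finset.sum_comm]
  refine Finset.sum_congr rfl fun i _ => ?_
  rw [Finset.sum_comm]
  simp only [← Finset.sum_mul, hT.orthogonal, ite_mul, one_mul, zero_mul, Finset.sum_ite_eq,
    Finset.mem_univ, if_true, real_inner_self_eq_norm_sq]

theorem eventuallyEq_transplant (hA : IsGluedTiling ΩA D S gA φ) (hB : IsGluedTiling ΩB D S gB ψ)
    (hinv : ∀ s, Involutive (gA s)) (hT : IsTransplantation gA gB T)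
    {u : EuclideanSpace ℝ (Fin n) → ℝ} (hu : ∀ x ∉ ΩA, u x = 0) (j : ι)
    {p : EuclideanSpace ℝ (Fin n)} (hp : p ∈ interior D) :
    transplant D T φ ψ u ∘ ψ j =ᶠ[𝓝 p] superpose T φ u j := by
  filter_upwards [isOpen_interior.mem_nhds hp] with q hq
  exact transplant_apply hA hB hinv hT hu j (interior_subset hq)

/-- Transplantation preserves the `L²` norm. -/
theorem integral_transplant_sq (hDc : Convex ℝ D) (hD : IsCompact D) (hΩB : IsOpen ΩB)
    (hA : IsGluedTiling ΩA D S gA φ) (hB : IsGluedTiling ΩB D S gB ψ)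
    (hinv : ∀ s, Involutive (gA s)) (hT : IsTransplantation gA gB T)
    {u : EuclideanSpace ℝ (Fin n) → ℝ} (hu : IsLipschitzZero ΩA u) :
    ∫ x, transplant D T φ ψ u x ^ 2 = ∫ x, u x ^ 2 := by
  have hv := isLipschitzZero_transplant hD hΩB hA hB hinv hT hu
  have hui : Integrable fun x => u x ^ 2 := by
    refine ((hu.integrable_inner hA.bounded hu).1).congr (Eventually.of_forall fun x => ?_)
    simp [pow_two]
  have hvi : Integrable fun x => transplant D T φ ψ u x ^ 2 := by
    refine ((hv.integrable_inner hB.bounded hv).1).congr (Eventually.of_forall fun x => ?_)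
    simp [pow_two]
  have hemb : ∀ (χ : ι → EuclideanSpace ℝ (Fin n) ≃ᵃⁱ[ℝ] EuclideanSpace ℝ (Fin n))
      (f : EuclideanSpace ℝ (Fin n) → ℝ), Integrable f → ∀ j,
      IntegrableOn (fun p => f (χ j p)) (interior D) := fun χ f hf j =>
    ((χ j).measurePreserving_euclideanSpace.integrable_comp_of_integrable hf).integrableOn
  rw [hB.integral_eq_sum hDc hD hvi (Eventually.of_forall fun x hx => by simp [hv.2 x hx]),
    hA.integral_eq_sum hDc hD hui (Eventually.of_forall fun x hx => by simp [hu.2 x hx]),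
    ← integral_finsetSum _ fun j _ => hemb ψ _ hvi j,
    ← integral_finsetSum _ fun j _ => hemb φ _ hui j]
  refine setIntegral_congr_fun isOpen_interior.measurableSet fun p hp => ?_
  have h := hT.sum_norm_sq fun i => u (φ i p)
  simp only [smul_eq_mul, Real.norm_eq_abs, sq_abs, ← superpose_apply] at h
  simp only [transplant_apply hA hB hinv hT hu.2 _ (interior_subset hp), h]

theorem ae_gradient_eq_zero {v : EuclideanSpace ℝ (Fin n) → ℝ} (hv : IsLipschitzZero ΩA v) :
    ∀ᵐ x, x ∉ ΩA → ‖∇ v x‖ ^ 2 = 0 := by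
  obtain ⟨⟨L, hL⟩, h0⟩ := hv
  filter_upwards [hL.ae_hasFDerivAt_zero_of_eq_zero] with x hx hxA
  rw [norm_gradient, (hx (h0 x hxA)).fderiv]
  simp

/-- Transplantation preserves the Dirichlet energy. -/
theorem integral_norm_gradient_transplant_sq (hDc : Convex ℝ D) (hD : IsCompact D)
    (hΩB : IsOpen ΩB) (hA : IsGluedTiling ΩA D S gA φ) (hB : IsGluedTiling ΩB D S gB ψ)
    (hinv : ∀ s, Involutive (gA s)) (hT : IsTransplantation gA gB T)
    {u : EuclideanSpace ℝ (Fin n) → ℝ} (hu : IsLipschitzZero ΩA u) (hud : Differentiable ℝ u) :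
    ∫ x, ‖∇ (transplant D T φ ψ u) x‖ ^ 2 = ∫ x, ‖∇ u x‖ ^ 2 := by
  have hv := isLipschitzZero_transplant hD hΩB hA hB hinv hT hu
  have hui : Integrable fun x => ‖∇ u x‖ ^ 2 := by
    refine ((hu.integrable_inner hA.bounded hu).2).congr (Eventually.of_forall fun x => ?_)
    simp
  have hvi : Integrable fun x => ‖∇ (transplant D T φ ψ u) x‖ ^ 2 := by
    refine ((hv.integrable_inner hB.bounded hv).2).congr (Eventually.of_forall fun x => ?_)
    simp
  have hemb : ∀ (χ : ι → EuclideanSpace ℝ (Fin n) ≃ᵃⁱ[ℝ] EuclideanSpace ℝ (Fin n))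
      (f : EuclideanSpace ℝ (Fin n) → ℝ), Integrable f → ∀ j,
      IntegrableOn (fun p => f (χ j p)) (interior D) := fun χ f hf j =>
    ((χ j).measurePreserving_euclideanSpace.integrable_comp_of_integrable hf).integrableOn
  rw [hB.integral_eq_sum hDc hD hvi (ae_gradient_eq_zero hv),
    hA.integral_eq_sum hDc hD hui (ae_gradient_eq_zero hu),
    ← integral_finsetSum _ fun j _ => hemb ψ _ hvi j,
    ← integral_finsetSum _ fun j _ => hemb φ _ hui j]
  refine setIntegral_congr_fun isOpen_interior.measurableSet fun p hp => ?_
  have hd : ∀ i, DifferentiableAt ℝ (u ∘ φ i) p := fun i =>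
    (hud _).comp p (φ i).hasFDerivAt_euclideanSpace.differentiableAt
  have hs : ∀ j, DifferentiableAt ℝ (superpose T φ u j) p := fun j => by
    unfold superpose
    exact DifferentiableAt.sum fun i _ => (hd i).const_smul _
  have h1 : ∀ j, ‖∇ (transplant D T φ ψ u) (ψ j p)‖ = ‖∇ (superpose T φ u j) p‖ := fun j => by
    have hev := eventuallyEq_transplant hA hB hinv hT hu.2 j hp
    have hdt : DifferentiableAt ℝ (transplant D T φ ψ u) (ψ j p) := by
      have h2 : DifferentiableAt ℝ (transplant D T φ ψ u ∘ ψ j) ((ψ j).symm (ψ j p)) := by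
        rw [AffineIsometryEquiv.symm_apply_apply]
        exact (hs j).congr_of_eventuallyEq hev
      have h3 := h2.comp (ψ j p) (ψ j).symm.hasFDerivAt_euclideanSpace.differentiableAt
      refine h3.congr_of_eventuallyEq (Eventually.of_forall fun x => ?_)
      simp
    rw [← norm_gradient_comp_affineIsometryEquiv (ψ j) hdt, norm_gradient, norm_gradient,
      hev.fderiv_eq]
  have h2 : ∀ i, ‖∇ (u ∘ φ i) p‖ = ‖∇ u (φ i p)‖ := fun i =>
    norm_gradient_comp_affineIsometryEquiv (φ i) (hud _)
  simp only [h1, ← h2, superpose, gradient_sum_smul hd]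
  exact hT.sum_norm_sq _

theorem exists_mem_rayleighValues_le_of_isTransplantation {k : ℕ} (hk : 1 ≤ k)
    (hDc : Convex ℝ D) (hD : IsCompact D)
    (hΩB : IsOpen ΩB) (hA : IsGluedTiling ΩA D S gA φ) (hB : IsGluedTiling ΩB D S gB ψ)
    (hinv : ∀ s, Involutive (gA s)) (hT : IsTransplantation gA gB T) {r ε : ℝ}
    (hr : r ∈ rayleighValues ΩA k) (hε : 0 < ε) : ∃ r' ∈ rayleighValues ΩB k, r' ≤ r + ε := by
  obtain ⟨u, hu, hpos, hle⟩ := exists_basis_of_mem_rayleighValues hA.bounded hk hr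
  have huz : ∀ i, IsLipschitzZero ΩA (u i) := fun i =>
    isLipschitzZero_of_contDiff (hu i).1 (hu i).2.1 (hu i).2.2
  have hvz := fun i => isLipschitzZero_transplant hD hΩB hA hB hinv hT (huz i)
  have hcz : ∀ c : Fin k → ℝ, IsLipschitzZero ΩA (∑ i, c i • u i) := fun c => by
    refine ⟨?_, fun x hx => ?_⟩
    · have h1 : ContDiff ℝ (⊤ : ℕ∞) (∑ i, c i • u i) := by
        have : ContDiff ℝ (⊤ : ℕ∞) fun x => ∑ i, c i • u i x :=
          ContDiff.sum fun i _ => contDiff_const.mul (hu i).1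
        convert this using 1
        ext x
        simp
      refine ContDiff.lipschitzWith_of_hasCompactSupport ?_ h1 (by simp)
      refine HasCompactSupport.intro hA.bounded.isCompact_closure fun x hx => ?_
      simp [fun i => (huz i).2 x fun h => hx (subset_closure h)]
    · simp [fun i => (huz i).2 x hx]
  have hcd : ∀ c : Fin k → ℝ, Differentiable ℝ (∑ i, c i • u i) := fun c =>
    Differentiable.sum fun i _ => ((hu i).1.differentiable (by simp)).const_smul _
  have hm : ∀ c, quadForm (massForm fun i => transplant D T φ ψ (u i)) c =
      quadForm (massForm u) c := fun c => by
    rw [quadForm_massForm hB.bounded hvz, quadForm_massForm hA.bounded huz, ← transplant_sum_smul,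
      integral_transplant_sq hDc hD hΩB hA hB hinv hT (hcz c)]
  have he : ∀ c, quadForm (energyForm fun i => transplant D T φ ψ (u i)) c =
      quadForm (energyForm u) c := fun c => by
    rw [quadForm_energyForm hB.bounded hvz, quadForm_energyForm hA.bounded huz,
      ← transplant_sum_smul,
      integral_norm_gradient_transplant_sq hDc hD hΩB hA hB hinv hT (hcz c) (hcd c)]
  refine exists_mem_rayleighValues_le hB.bounded hvz (nonneg_of_mem_rayleighValues hr) hε
    (fun c hc => ?_) fun c => ?_
  · rw [hm]; exact hpos c hc
  · rw [hm, he]; exact hle c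

theorem IsTransplantation.symm (hT : IsTransplantation gA gB T) : IsTransplantation gB gA fun i j => T j i where
  orthogonal i i' := by
    have h1 : (Matrix.of T).transpose * Matrix.of T = 1 := by
      ext a b
      simp [Matrix.mul_apply, hT.orthogonal, Matrix.one_apply]
    have h2 : Matrix.of T * (Matrix.of T).transpose = 1 := mul_eq_one_comm.1 h1
    have h3 := congrFun (congrFun h2 i) i'
    simpa [Matrix.mul_apply, Matrix.one_apply] using h3
  intertwine s i j := by
    have hsq : ∀ (g : κ → ι → ι) (a : ι), boundarySign g s a * boundarySign g s a = 1 :=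
      fun g a => by unfold boundarySign; split_ifs <;> norm_num
    rw [hT.intertwine s j i]
    linear_combination (-1 : ℝ) * T j (gA s i) * (boundarySign gB s j * boundarySign gB s j) * hsq gA i
      - T j (gA s i) * hsq gB j

/-- Sets tiled according to gluing patterns that are intertwined by an orthogonal matrix are
Dirichlet isospectral. -/
theorem dirichletEig_eq_of_isTransplantation {k : ℕ} (hk : 1 ≤ k)
    (hDc : Convex ℝ D) (hD : IsCompact D) (hΩA : IsOpen ΩA) (hΩB : IsOpen ΩB)
    (hA : IsGluedTiling ΩA D S gA φ) (hB : IsGluedTiling ΩB D S gB ψ)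
    (hinvA : ∀ s, Involutive (gA s)) (hinvB : ∀ s, Involutive (gB s))
    (hT : IsTransplantation gA gB T) : dirichletEig ΩA k = dirichletEig ΩB k := by
  rw [dirichletEig_eq_sInf, dirichletEig_eq_sInf]
  have h1 : ∀ r ∈ rayleighValues ΩA k, ∀ ε > 0, ∃ r' ∈ rayleighValues ΩB k, r' ≤ r + ε :=
    fun r hr ε hε => exists_mem_rayleighValues_le_of_isTransplantation hk hDc hD hΩB hA hB hinvA
      hT hr hε
  have h2 : ∀ r ∈ rayleighValues ΩB k, ∀ ε > 0, ∃ r' ∈ rayleighValues ΩA k, r' ≤ r + ε :=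
    fun r hr ε hε => exists_mem_rayleighValues_le_of_isTransplantation hk hDc hD hΩA hB hA hinvB
      hT.symm hr hε
  rcases (rayleighValues ΩA k).eq_empty_or_nonempty with he | hne
  · rcases (rayleighValues ΩB k).eq_empty_or_nonempty with he' | ⟨r, hr⟩
    · rw [he, he']
    · obtain ⟨r', hr', -⟩ := h2 r hr 1 one_pos
      rw [he] at hr'
      exact absurd hr' (notMem_empty _)
  · obtain ⟨r, hr⟩ := id hne
    obtain ⟨r', hr', -⟩ := h1 r hr 1 one_pos
    exact le_antisymm
      (sInf_le_sInf_of_forall_exists_le (fun _ => nonneg_of_mem_rayleighValues) ⟨r', hr'⟩ h2)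
      (sInf_le_sInf_of_forall_exists_le (fun _ => nonneg_of_mem_rayleighValues) ⟨r, hr⟩ h1)

end Transplantation

section PlaneGeometry

open Set Function Topology Filter

theorem pt_apply_zero (a b : ℝ) : pt a b 0 = a := rfl

theorem pt_apply_one (a b : ℝ) : pt a b 1 = b := rfl

theorem plane_ext {p q : EuclideanSpace ℝ (Fin 2)} (h0 : p 0 = q 0) (h1 : p 1 = q 1) : p = q := by
  ext i
  fin_cases i
  · exact h0
  · exact h1

theorem dist_sq_plane (p q : EuclideanSpace ℝ (Fin 2)) :
    dist p q ^ 2 = (p 0 - q 0) ^ 2 + (p 1 - q 1) ^ 2 := by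
  rw [EuclideanSpace.dist_eq, Real.sq_sqrt (Finset.sum_nonneg fun _ _ => sq_nonneg _)]
  simp [Fin.sum_univ_two, Real.dist_eq]

/-- The map `(x, y) ↦ (m₀ x + m₁ y + m₂, m₃ x + m₄ y + m₅)`. -/
noncomputable def latticeMap (m : Fin 6 → ℤ) (p : EuclideanSpace ℝ (Fin 2)) :
    EuclideanSpace ℝ (Fin 2) :=
  pt (m 0 * p 0 + m 1 * p 1 + m 2) (m 3 * p 0 + m 4 * p 1 + m 5)

/-- The linear part of `latticeMap m` is orthogonal. -/
def IsOrthogonalData (m : Fin 6 → ℤ) : Prop :=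
  (m 0 * m 0 + m 3 * m 3 = 1 ∧ m 1 * m 1 + m 4 * m 4 = 1 ∧ m 0 * m 1 + m 3 * m 4 = 0) ∧
    m 0 * m 0 + m 1 * m 1 = 1 ∧ m 3 * m 3 + m 4 * m 4 = 1 ∧ m 0 * m 3 + m 1 * m 4 = 0

instance (m : Fin 6 → ℤ) : Decidable (IsOrthogonalData m) := by
  unfold IsOrthogonalData
  infer_instance

/-- `latticeMap m` as an affine isometry. -/
noncomputable def latticeIsometry (m : Fin 6 → ℤ) (hm : IsOrthogonalData m) :
    EuclideanSpace ℝ (Fin 2) ≃ᵃⁱ[ℝ] EuclideanSpace ℝ (Fin 2) :=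
  (IsometryEquiv.mk' (latticeMap m)
    (fun p => pt (m 0 * (p 0 - m 2) + m 3 * (p 1 - m 5)) (m 1 * (p 0 - m 2) + m 4 * (p 1 - m 5)))
    (fun p => by
      obtain ⟨-, h1, h2, h3⟩ := hm
      have h1 : (m 0 * m 0 + m 1 * m 1 : ℝ) = 1 := mod_cast h1
      have h2 : (m 3 * m 3 + m 4 * m 4 : ℝ) = 1 := mod_cast h2
      have h3 : (m 0 * m 3 + m 1 * m 4 : ℝ) = 0 := mod_cast h3
      refine plane_ext ?_ ?_
      · simp only [latticeMap, pt_apply_zero, pt_apply_one]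
        linear_combination (p 0 - m 2) * h1 + (p 1 - m 5) * h3
      · simp only [latticeMap, pt_apply_zero, pt_apply_one]
        linear_combination (p 0 - m 2) * h3 + (p 1 - m 5) * h2)
    (Isometry.of_dist_eq fun p q => by
      obtain ⟨⟨h1, h2, h3⟩, -⟩ := hm
      have h1 : (m 0 * m 0 + m 3 * m 3 : ℝ) = 1 := mod_cast h1
      have h2 : (m 1 * m 1 + m 4 * m 4 : ℝ) = 1 := mod_cast h2
      have h3 : (m 0 * m 1 + m 3 * m 4 : ℝ) = 0 := mod_cast h3
      rw [← sq_eq_sq₀ dist_nonneg dist_nonneg, dist_sq_plane, dist_sq_plane]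
      simp only [latticeMap, pt_apply_zero, pt_apply_one]
      linear_combination (p 0 - q 0) ^ 2 * h1 + (p 1 - q 1) ^ 2 * h2 +
        2 * (p 0 - q 0) * (p 1 - q 1) * h3)).toRealAffineIsometryEquiv

theorem latticeIsometry_apply {m : Fin 6 → ℤ} (hm : IsOrthogonalData m)
    (p : EuclideanSpace ℝ (Fin 2)) : latticeIsometry m hm p = latticeMap m p := rfl

/-- The linear forms defining the sides of the tile. -/
noncomputable def sideForm (s : Fin 3) (p : EuclideanSpace ℝ (Fin 2)) : ℝ :=
  ![p 1, p 0 - p 1, 1 - p 0 - p 1] s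

/-- The triangle with vertices `(0, 0)`, `(1, 0)` and `(1/2, 1/2)`. -/
def tile : Set (EuclideanSpace ℝ (Fin 2)) := {p | ∀ s, 0 ≤ sideForm s p}

/-- The sides of the tile. -/
def tileSide (s : Fin 3) : Set (EuclideanSpace ℝ (Fin 2)) := {p | p ∈ tile ∧ sideForm s p = 0}

/-- The data of the reflections in the sides of the tile. -/
def reflectionData (s : Fin 3) : Fin 6 → ℤ :=
  ![![1, 0, 0, 0, -1, 0], ![0, 1, 0, 1, 0, 0], ![0, -1, 1, -1, 0, 1]] s

theorem mem_tile {p : EuclideanSpace ℝ (Fin 2)} :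
    p ∈ tile ↔ 0 ≤ p 1 ∧ 0 ≤ p 0 - p 1 ∧ 0 ≤ 1 - p 0 - p 1 := by
  simp only [tile, mem_ofPred_eq, Fin.forall_fin_succ, sideForm]
  simp

theorem tri_eq_tile : tri (pt 0 0) (pt 1 0) (pt 0.5 0.5) = tile := by
  refine Subset.antisymm (convexHull_min ?_ ?_) fun p hp => ?_
  · rintro p (rfl | rfl | rfl) <;> rw [mem_tile] <;> norm_num [pt_apply_zero, pt_apply_one]
  · rintro p hp q hq a b ha hb hab
    rw [mem_tile] at *
    obtain ⟨h1, h2, h3⟩ := hp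
    obtain ⟨h4, h5, h6⟩ := hq
    obtain rfl : b = 1 - a := by linarith
    simp only [PiLp.add_apply, PiLp.smul_apply, smul_eq_mul]
    refine ⟨by positivity, ?_, ?_⟩
    · linarith [mul_nonneg ha h2, mul_nonneg hb h5]
    · linarith [mul_nonneg ha h3, mul_nonneg hb h6]
  · rw [mem_tile] at hp
    obtain ⟨h1, h2, h3⟩ := hp
    have hw : ∀ i ∈ (Finset.univ : Finset (Fin 3)),
        0 ≤ (![1 - p 0 - p 1, p 0 - p 1, 2 * p 1] : Fin 3 → ℝ) i := by
      intro i _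
      fin_cases i
      · exact h3
      · exact h2
      · show 0 ≤ 2 * p 1
        linarith
    have h := (convex_convexHull ℝ {pt 0 0, pt 1 0, pt 0.5 0.5}).sum_mem
      (z := ![pt 0 0, pt 1 0, pt 0.5 0.5]) hw (by simp [Fin.sum_univ_three]; ring) (by
        intro i _
        fin_cases i <;> exact subset_convexHull _ _ (by simp))
    have hs : ∑ i, (![1 - p 0 - p 1, p 0 - p 1, 2 * p 1] : Fin 3 → ℝ) i •
        (![pt 0 0, pt 1 0, pt 0.5 0.5] : Fin 3 → EuclideanSpace ℝ (Fin 2)) i = p := by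
      refine plane_ext ?_ ?_ <;>
      · simp [Fin.sum_univ_three, pt_apply_zero, pt_apply_one]
        ring
    rwa [hs] at h

theorem convex_tile : Convex ℝ tile := by
  rw [← tri_eq_tile]
  exact convex_convexHull ℝ _

theorem isCompact_tile : IsCompact tile := by
  rw [← tri_eq_tile]
  exact (Set.toFinite _).isCompact_convexHull ℝ

theorem image_tile (e : EuclideanSpace ℝ (Fin 2) ≃ᵃⁱ[ℝ] EuclideanSpace ℝ (Fin 2)) :
    e '' tile = tri (e (pt 0 0)) (e (pt 1 0)) (e (pt 0.5 0.5)) := by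
  rw [← tri_eq_tile, tri, tri]
  have h := e.toAffineEquiv.toAffineMap.image_convexHull ({pt 0 0, pt 1 0, pt 0.5 0.5} : Set _)
  rw [image_insert_eq, image_pair] at h
  exact h

/-- The points on the other side of the side `s`, close to the tile. -/
def outerTile (s : Fin 3) : Set (EuclideanSpace ℝ (Fin 2)) :=
  {q | ∀ t, 0 < sideForm t (latticeMap (reflectionData s) q)}

theorem mem_outerTile_zero {q : EuclideanSpace ℝ (Fin 2)} :
    q ∈ outerTile 0 ↔ q 1 < 0 ∧ 0 < q 0 + q 1 ∧ 0 < 1 - q 0 + q 1 := by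
  simp only [outerTile, mem_ofPred_eq, Fin.forall_fin_succ, sideForm, latticeMap, reflectionData]
  simp [pt_apply_zero, pt_apply_one]

theorem mem_outerTile_one {q : EuclideanSpace ℝ (Fin 2)} :
    q ∈ outerTile 1 ↔ 0 < q 0 ∧ 0 < q 1 - q 0 ∧ 0 < 1 - q 0 - q 1 := by
  simp only [outerTile, mem_ofPred_eq, Fin.forall_fin_succ, sideForm, latticeMap, reflectionData]
  simp [pt_apply_zero, pt_apply_one]
  intros
  constructor <;> intro h <;> linarith

theorem mem_outerTile_two {q : EuclideanSpace ℝ (Fin 2)} :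
    q ∈ outerTile 2 ↔ 0 < 1 - q 0 ∧ 0 < q 0 - q 1 ∧ 0 < q 0 + q 1 - 1 := by
  simp only [outerTile, mem_ofPred_eq, Fin.forall_fin_succ, sideForm, latticeMap, reflectionData]
  simp [pt_apply_zero, pt_apply_one]

theorem lineMap_mem_outerTile {s : Fin 3} {p : EuclideanSpace ℝ (Fin 2)} (hp : p ∈ tileSide s)
    {t : ℝ} (ht : t ∈ Ioc (0 : ℝ) 1) :
    AffineMap.lineMap p (![pt 0.5 (-0.2), pt 0.2 0.5, pt 0.8 0.5] s) t ∈ outerTile s := by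
  obtain ⟨hp, hs⟩ := hp
  obtain ⟨h1, h2, h3⟩ := mem_tile.1 hp
  obtain ⟨ht0, ht1⟩ := ht
  have ht2 := sub_nonneg.2 ht1
  have m1 := mul_nonneg ht2 h1
  have m2 := mul_nonneg ht2 h2
  have m3 := mul_nonneg ht2 h3
  fin_cases s
  · replace hs : p 1 = 0 := hs
    rw [Fin.zero_eta, mem_outerTile_zero]
    simp [AffineMap.lineMap_apply, pt_apply_zero, pt_apply_one]
    rw [hs] at *
    refine ⟨?_, ?_, ?_⟩ <;> nlinarith
  · replace hs : p 0 - p 1 = 0 := hs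
    obtain hs : p 1 = p 0 := by linarith
    rw [Fin.mk_one, mem_outerTile_one]
    simp [AffineMap.lineMap_apply, pt_apply_zero, pt_apply_one]
    rw [hs] at *
    refine ⟨?_, ?_, ?_⟩ <;> nlinarith
  · replace hs : 1 - p 0 - p 1 = 0 := hs
    obtain hs : p 1 = 1 - p 0 := by linarith
    rw [show (⟨2, by omega⟩ : Fin 3) = 2 from rfl, mem_outerTile_two]
    simp [AffineMap.lineMap_apply, pt_apply_zero, pt_apply_one]
    rw [hs] at *
    refine ⟨?_, ?_, ?_⟩ <;> nlinarith

theorem tileSide_subset_closure_outerTile (s : Fin 3) : tileSide s ⊆ closure (outerTile s) := by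
  intro p hp
  have h : Tendsto (fun t : ℝ => AffineMap.lineMap p (![pt 0.5 (-0.2), pt 0.2 0.5, pt 0.8 0.5] s) t)
      (𝓝[>] 0) (𝓝 p) := by
    have := (AffineMap.lineMap_continuous (R := ℝ) (p := p)
      (q := ![pt 0.5 (-0.2), pt 0.2 0.5, pt 0.8 0.5] s)).tendsto 0
    rw [AffineMap.lineMap_apply_zero] at this
    exact this.mono_left nhdsWithin_le_nhds
  refine mem_closure_of_tendsto h ?_
  filter_upwards [Ioc_mem_nhdsGT (zero_lt_one (α := ℝ))] with t ht
  exact lineMap_mem_outerTile hp ht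

theorem disjoint_outerTile_tile (s : Fin 3) {q : EuclideanSpace ℝ (Fin 2)} (hq : q ∈ outerTile s) :
    q ∉ tile := by
  rw [mem_tile]
  rintro ⟨h1, h2, h3⟩
  fin_cases s
  · obtain ⟨h4, h5, h6⟩ := mem_outerTile_zero.1 hq
    linarith
  · obtain ⟨h4, h5, h6⟩ := mem_outerTile_one.1 hq
    linarith
  · obtain ⟨h4, h5, h6⟩ := mem_outerTile_two.1 hq
    linarith

theorem notMem_interior_tile {s : Fin 3} {p : EuclideanSpace ℝ (Fin 2)} (hp : p ∈ tileSide s) :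
    p ∉ interior tile := fun h => by
  obtain ⟨q, hq, hqs⟩ := mem_closure_iff.1 (tileSide_subset_closure_outerTile s hp) _
    isOpen_interior h
  exact disjoint_outerTile_tile s hqs (interior_subset hq)

theorem continuous_sideForm (s : Fin 3) : Continuous (sideForm s) := by
  fin_cases s
  · exact (by fun_prop : Continuous fun p : EuclideanSpace ℝ (Fin 2) => p 1)
  · exact (by fun_prop : Continuous fun p : EuclideanSpace ℝ (Fin 2) => p 0 - p 1)
  · exact (by fun_prop : Continuous fun p : EuclideanSpace ℝ (Fin 2) => 1 - p 0 - p 1)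

theorem continuous_latticeMap (m : Fin 6 → ℤ) : Continuous (latticeMap m) := by
  unfold latticeMap pt
  refine (PiLp.continuous_toLp 2 _).comp (continuous_pi fun i => ?_)
  fin_cases i <;> simp <;> fun_prop

theorem latticeMap_reflectionData_of_mem {s : Fin 3} {p : EuclideanSpace ℝ (Fin 2)}
    (hp : p ∈ tileSide s) : latticeMap (reflectionData s) p = p := by
  obtain ⟨-, hs⟩ := hp
  fin_cases s
  · replace hs : p 1 = 0 := hs
    refine plane_ext ?_ ?_ <;> simp [latticeMap, reflectionData, pt_apply_zero, pt_apply_one, hs]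
  · replace hs : p 0 - p 1 = 0 := hs
    refine plane_ext ?_ ?_ <;> simp [latticeMap, reflectionData, pt_apply_zero, pt_apply_one] <;>
      linarith
  · replace hs : 1 - p 0 - p 1 = 0 := hs
    refine plane_ext ?_ ?_ <;> simp [latticeMap, reflectionData, pt_apply_zero, pt_apply_one] <;>
      linarith

/-- Near a point of the side `s` which is not a vertex, any point is in the tile or in its
reflection. -/
theorem exists_isOpen_of_mem_tileSide {s : Fin 3} {p : EuclideanSpace ℝ (Fin 2)}
    (hp : p ∈ tileSide s) (hv : ∀ t, s ≠ t → p ∉ tileSide t) :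
    ∃ V, IsOpen V ∧ p ∈ V ∧ ∀ q ∈ V, q ∈ tile ∨ latticeMap (reflectionData s) q ∈ tile := by
  have hpos : ∀ t, s ≠ t → 0 < sideForm t p := fun t hst =>
    (hp.1 t).lt_of_ne fun h => hv t hst ⟨hp.1, h.symm⟩
  refine ⟨{q | ∀ t, s ≠ t → 0 < sideForm t q ∧
    0 < sideForm t (latticeMap (reflectionData s) q)}, ?_, ?_, ?_⟩
  · simp only [ofPred_forall]
    refine isOpen_iInter_of_finite fun t => isOpen_iInter_of_finite fun _ => ?_
    exact (isOpen_lt continuous_const (continuous_sideForm t)).inter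
      (isOpen_lt continuous_const ((continuous_sideForm t).comp (continuous_latticeMap _)))
  · intro t hst
    rw [latticeMap_reflectionData_of_mem hp]
    exact ⟨hpos t hst, hpos t hst⟩
  · intro q hq
    have hneg : sideForm s (latticeMap (reflectionData s) q) = -sideForm s q := by
      fin_cases s <;> simp [sideForm, latticeMap, reflectionData, pt_apply_zero, pt_apply_one]
      ring
    rcases le_total 0 (sideForm s q) with h | h
    · refine Or.inl fun t => ?_
      by_cases hst : s = t
      · rwa [← hst]
      · exact (hq t hst).1.le
    · refine Or.inr fun t => ?_
      by_cases hst : s = t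
      · rw [← hst, hneg]
        linarith
      · exact (hq t hst).2.le

theorem mem_interior_tile {p : EuclideanSpace ℝ (Fin 2)} (hp : p ∈ tile)
    (hs : ∀ s, p ∉ tileSide s) : p ∈ interior tile := by
  have h : IsOpen {q : EuclideanSpace ℝ (Fin 2) | ∀ s, 0 < sideForm s q} := by
    simp only [ofPred_forall]
    exact isOpen_iInter_of_finite fun t => isOpen_lt continuous_const (continuous_sideForm t)
  exact interior_maximal (fun q hq s => (hq s).le) h
    fun s => (hp s).lt_of_ne fun h => hs s ⟨hp, h.symm⟩

/-- A criterion for a union of isometric copies of the tile to be a glued tiling. -/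
theorem isGluedTiling_of_reflections {ι : Type*} [Fintype ι] {g : Fin 3 → ι → ι}
    {φ : ι → EuclideanSpace ℝ (Fin 2) ≃ᵃⁱ[ℝ] EuclideanSpace ℝ (Fin 2)}
    (hrefl : ∀ s i, g s i ≠ i → ∀ q, φ (g s i) (latticeMap (reflectionData s) q) = φ i q)
    (hout : ∀ s i, g s i = i → ∀ q ∈ outerTile s, ∀ j, ∀ p ∈ tile, φ i q ≠ φ j p)
    (hvertex : ∀ s t i, s ≠ t → ∃ j, (g s j = j ∨ g t j = j) ∧
      (j = i ∨ j = g s i ∨ j = g t i ∨ j = g s (g t i) ∨ j = g t (g s i) ∨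
        j = g s (g t (g s i)) ∨ j = g t (g s (g t i))))
    (hmeet : ∀ i j, ∀ p ∈ tile, ∀ q ∈ tile, φ i p = φ j q → p = q ∧
      (i = j ∨ (∃ s, sideForm s p = 0 ∧ g s i = j) ∨
        ∃ s t, s ≠ t ∧ sideForm s p = 0 ∧ sideForm t p = 0)) :
    IsGluedTiling (interior (⋃ i, φ i '' tile)) tile tileSide g φ := by
  have hcont : ∀ i, Continuous (φ i) := fun i => (φ i).continuous
  have hmem : ∀ i, ∀ p ∈ tile, φ i p ∈ ⋃ i, φ i '' tile := fun i p hp =>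
    mem_iUnion.2 ⟨i, p, hp, rfl⟩
  have hglue : ∀ s i, ∀ p ∈ tileSide s, φ (g s i) p = φ i p := fun s i p hp => by
    by_cases h : g s i = i
    · rw [h]
    · rw [← hrefl s i h p, latticeMap_reflectionData_of_mem hp]
  have hboundary : ∀ s i, ∀ p ∈ tileSide s, g s i = i → φ i p ∉ interior (⋃ i, φ i '' tile) := by
    intro s i p hp hi hmem
    obtain ⟨q, hq, hqs⟩ := mem_closure_iff.1 (tileSide_subset_closure_outerTile s hp) _
      (isOpen_interior.preimage (hcont i)) hmem
    obtain ⟨j, p', hp', h⟩ := mem_iUnion.1 (interior_subset hq)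
    exact hout s i hi q hqs j p' hp' h.symm
  have hmeet' : ∀ i j, ∀ p ∈ tile, ∀ q ∈ tile, φ i p = φ j q → p = q ∧
      (i = j ∨ (∃ s, p ∈ tileSide s ∧ g s i = j) ∨
        ∃ s t, s ≠ t ∧ p ∈ tileSide s ∧ p ∈ tileSide t) := by
    intro i j p hp q hq h
    obtain ⟨h1, h2 | ⟨s, h2, h3⟩ | ⟨s, t, h2, h3, h4⟩⟩ := hmeet i j p hp q hq h
    · exact ⟨h1, Or.inl h2⟩
    · exact ⟨h1, Or.inr (Or.inl ⟨s, ⟨hp, h2⟩, h3⟩)⟩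
    · exact ⟨h1, Or.inr (Or.inr ⟨s, t, h2, ⟨hp, h3⟩, ⟨hp, h4⟩⟩)⟩
  refine ⟨?_, interior_subset, ?_, hglue, hboundary, ?_, hmeet', ?_⟩
  · exact (isCompact_iUnion fun i => isCompact_tile.image (hcont i)).isBounded.subset
      interior_subset
  · intro i j hij
    rw [Function.onFun, disjoint_left]
    rintro _ ⟨p, hp, rfl⟩ ⟨q, hq, h⟩
    obtain ⟨-, h2 | ⟨s, h2, h3⟩ | ⟨s, t, h2, h3, h4⟩⟩ :=
      hmeet' i j p (interior_subset hp) q (interior_subset hq) h.symm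
    · exact hij h2
    · exact notMem_interior_tile h2 hp
    · exact notMem_interior_tile h3 hp
  · intro s t i p hst hs ht
    obtain ⟨j, hj, h⟩ := hvertex s t i hst
    have hij : φ j p = φ i p := by
      rcases h with rfl | rfl | rfl | rfl | rfl | rfl | rfl <;>
        simp only [hglue s _ p hs, hglue t _ p ht]
    rw [← hij]
    rcases hj with hj | hj
    · exact hboundary s j p hs hj
    · exact hboundary t j p ht hj
  · intro i p hp hpi
    by_contra! hcon
    refine hpi ?_
    by_cases h : ∃ s, p ∈ tileSide s
    · obtain ⟨s, hs⟩ := h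
      obtain ⟨h1, h2⟩ := hcon s hs
      obtain ⟨V, hV, hpV, hVt⟩ := exists_isOpen_of_mem_tileSide hs h2
      refine interior_maximal ?_ ((φ i).toHomeomorph.isOpenMap V hV) ⟨p, hpV, rfl⟩
      rintro _ ⟨q, hq, rfl⟩
      rcases hVt q hq with h | h
      · exact hmem i q h
      · have := hmem (g s i) _ h
        rwa [hrefl s i h1 q] at this
    · push Not at h
      refine interior_maximal ?_ ((φ i).toHomeomorph.isOpenMap _ isOpen_interior)
        ⟨p, mem_interior_tile hp h, rfl⟩
      rintro _ ⟨q, hq, rfl⟩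
      exact hmem i q (interior_subset hq)

end PlaneGeometry

section GordonWebbWolpert

open Set Function

/-- The isometries placing the tiles of `gwwA`. -/
def tileDataA : Fin 7 → Fin 6 → ℤ :=
  ![![0, 1, 0, 1, 0, 0], ![1, 0, 0, 0, 1, 0], ![0, -1, 1, -1, 0, 1], ![0, 1, 1, -1, 0, 1],
    ![0, -1, 2, 1, 0, 0], ![1, 0, 1, 0, -1, 1], ![1, 0, 1, 0, 1, 1]]

/-- The isometries placing the tiles of `gwwB`. -/
def tileDataB : Fin 7 → Fin 6 → ℤ :=
  ![![-1, 0, 1, 0, -1, 0], ![-1, 0, 1, 0, 1, 0], ![0, 1, 0, -1, 0, 1], ![1, 0, 0, 0, -1, 1],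
    ![1, 0, 0, 0, 1, 1], ![0, -1, 1, -1, 0, 2], ![0, 1, 0, 1, 0, 1]]

/-- The gluing pattern of `gwwA`. -/
def gluingA : Fin 3 → Fin 7 → Fin 7 :=
  ![![0, 1, 3, 2, 4, 6, 5], ![1, 0, 2, 5, 4, 3, 6], ![0, 2, 1, 3, 5, 4, 6]]

/-- The gluing pattern of `gwwB`. -/
def gluingB : Fin 3 → Fin 7 → Fin 7 :=
  ![![1, 0, 2, 4, 3, 5, 6], ![0, 1, 3, 2, 6, 5, 4], ![0, 2, 1, 3, 5, 4, 6]]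

theorem isOrthogonalData_tileDataA : ∀ i, IsOrthogonalData (tileDataA i) := by decide

theorem isOrthogonalData_tileDataB : ∀ i, IsOrthogonalData (tileDataB i) := by decide

noncomputable def placeA (i : Fin 7) : EuclideanSpace ℝ (Fin 2) ≃ᵃⁱ[ℝ] EuclideanSpace ℝ (Fin 2) :=
  latticeIsometry (tileDataA i) (isOrthogonalData_tileDataA i)

noncomputable def placeB (i : Fin 7) : EuclideanSpace ℝ (Fin 2) ≃ᵃⁱ[ℝ] EuclideanSpace ℝ (Fin 2) :=
  latticeIsometry (tileDataB i) (isOrthogonalData_tileDataB i)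

theorem latticeMap_comp_reflectionData {m m' : Fin 6 → ℤ} {s : Fin 3}
    (h : m' 0 * reflectionData s 0 + m' 1 * reflectionData s 3 = m 0 ∧
      m' 0 * reflectionData s 1 + m' 1 * reflectionData s 4 = m 1 ∧
      m' 0 * reflectionData s 2 + m' 1 * reflectionData s 5 + m' 2 = m 2 ∧
      m' 3 * reflectionData s 0 + m' 4 * reflectionData s 3 = m 3 ∧
      m' 3 * reflectionData s 1 + m' 4 * reflectionData s 4 = m 4 ∧
      m' 3 * reflectionData s 2 + m' 4 * reflectionData s 5 + m' 5 = m 5)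
    (q : EuclideanSpace ℝ (Fin 2)) :
    latticeMap m' (latticeMap (reflectionData s) q) = latticeMap m q := by
  obtain ⟨h0, h1, h2, h3, h4, h5⟩ := h
  refine plane_ext ?_ ?_
  · simp only [latticeMap, pt_apply_zero, pt_apply_one, ← h0, ← h1, ← h2]
    push_cast
    ring
  · simp only [latticeMap, pt_apply_zero, pt_apply_one, ← h3, ← h4, ← h5]
    push_cast
    ring

theorem placeA_outer (s : Fin 3) (i : Fin 7) (hs : gluingA s i = i)
    (q : EuclideanSpace ℝ (Fin 2)) (hq : q ∈ outerTile s) (j : Fin 7)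
    (p : EuclideanSpace ℝ (Fin 2)) (hp : p ∈ tile) : placeA i q ≠ placeA j p := by
  intro h
  have h0 := congrArg (fun x : EuclideanSpace ℝ (Fin 2) => x 0) h
  have h1 := congrArg (fun x : EuclideanSpace ℝ (Fin 2) => x 1) h
  simp only [placeA, latticeIsometry_apply, latticeMap, pt_apply_zero, pt_apply_one] at h0 h1
  clear h
  obtain ⟨p1, p2, p3⟩ := mem_tile.1 hp
  fin_cases s
  · obtain ⟨q1, q2, q3⟩ := mem_outerTile_zero.1 hq
    fin_cases i <;> first
      | exact absurd hs (by decide)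
      | fin_cases j <;> simp [tileDataA] at h0 h1 <;> linarith
  · obtain ⟨q1, q2, q3⟩ := mem_outerTile_one.1 hq
    fin_cases i <;> first
      | exact absurd hs (by decide)
      | fin_cases j <;> simp [tileDataA] at h0 h1 <;> linarith
  · obtain ⟨q1, q2, q3⟩ := mem_outerTile_two.1 hq
    fin_cases i <;> first
      | exact absurd hs (by decide)
      | fin_cases j <;> simp [tileDataA] at h0 h1 <;> linarith

theorem placeB_outer (s : Fin 3) (i : Fin 7) (hs : gluingB s i = i)
    (q : EuclideanSpace ℝ (Fin 2)) (hq : q ∈ outerTile s) (j : Fin 7)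
    (p : EuclideanSpace ℝ (Fin 2)) (hp : p ∈ tile) : placeB i q ≠ placeB j p := by
  intro h
  have h0 := congrArg (fun x : EuclideanSpace ℝ (Fin 2) => x 0) h
  have h1 := congrArg (fun x : EuclideanSpace ℝ (Fin 2) => x 1) h
  simp only [placeB, latticeIsometry_apply, latticeMap, pt_apply_zero, pt_apply_one] at h0 h1
  clear h
  obtain ⟨p1, p2, p3⟩ := mem_tile.1 hp
  fin_cases s
  · obtain ⟨q1, q2, q3⟩ := mem_outerTile_zero.1 hq
    fin_cases i <;> first
      | exact absurd hs (by decide)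
      | fin_cases j <;> simp [tileDataB] at h0 h1 <;> linarith
  · obtain ⟨q1, q2, q3⟩ := mem_outerTile_one.1 hq
    fin_cases i <;> first
      | exact absurd hs (by decide)
      | fin_cases j <;> simp [tileDataB] at h0 h1 <;> linarith
  · obtain ⟨q1, q2, q3⟩ := mem_outerTile_two.1 hq
    fin_cases i <;> first
      | exact absurd hs (by decide)
      | fin_cases j <;> simp [tileDataB] at h0 h1 <;> linarith

theorem placeA_meet (i j : Fin 7) (p : EuclideanSpace ℝ (Fin 2)) (hp : p ∈ tile)
    (q : EuclideanSpace ℝ (Fin 2)) (hq : q ∈ tile) (h : placeA i p = placeA j q) : p = q ∧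
      (i = j ∨ (∃ s, sideForm s p = 0 ∧ gluingA s i = j) ∨
        ∃ s t, s ≠ t ∧ sideForm s p = 0 ∧ sideForm t p = 0) := by
  have h0 := congrArg (fun x : EuclideanSpace ℝ (Fin 2) => x 0) h
  have h1 := congrArg (fun x : EuclideanSpace ℝ (Fin 2) => x 1) h
  simp only [placeA, latticeIsometry_apply, latticeMap, pt_apply_zero, pt_apply_one] at h0 h1
  clear h
  obtain ⟨p1, p2, p3⟩ := mem_tile.1 hp
  obtain ⟨q1, q2, q3⟩ := mem_tile.1 hq
  have e0 : sideForm 0 p = p 1 := rfl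
  have e1 : sideForm 1 p = p 0 - p 1 := rfl
  have e2 : sideForm 2 p = 1 - p 0 - p 1 := rfl
  fin_cases i <;> fin_cases j <;> simp [tileDataA] at h0 h1 <;>
    refine ⟨plane_ext (by linarith) (by linarith), ?_⟩ <;> first
    | exact Or.inl rfl
    | exact Or.inr (Or.inl ⟨0, by linarith, by decide⟩)
    | exact Or.inr (Or.inl ⟨1, by linarith, by decide⟩)
    | exact Or.inr (Or.inl ⟨2, by linarith, by decide⟩)
    | exact Or.inr (Or.inr ⟨0, 1, by decide, by linarith, by linarith⟩)
    | exact Or.inr (Or.inr ⟨0, 2, by decide, by linarith, by linarith⟩)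
    | exact Or.inr (Or.inr ⟨1, 2, by decide, by linarith, by linarith⟩)

theorem placeB_meet (i j : Fin 7) (p : EuclideanSpace ℝ (Fin 2)) (hp : p ∈ tile)
    (q : EuclideanSpace ℝ (Fin 2)) (hq : q ∈ tile) (h : placeB i p = placeB j q) : p = q ∧
      (i = j ∨ (∃ s, sideForm s p = 0 ∧ gluingB s i = j) ∨
        ∃ s t, s ≠ t ∧ sideForm s p = 0 ∧ sideForm t p = 0) := by
  have h0 := congrArg (fun x : EuclideanSpace ℝ (Fin 2) => x 0) h
  have h1 := congrArg (fun x : EuclideanSpace ℝ (Fin 2) => x 1) h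
  simp only [placeB, latticeIsometry_apply, latticeMap, pt_apply_zero, pt_apply_one] at h0 h1
  clear h
  obtain ⟨p1, p2, p3⟩ := mem_tile.1 hp
  obtain ⟨q1, q2, q3⟩ := mem_tile.1 hq
  have e0 : sideForm 0 p = p 1 := rfl
  have e1 : sideForm 1 p = p 0 - p 1 := rfl
  have e2 : sideForm 2 p = 1 - p 0 - p 1 := rfl
  fin_cases i <;> fin_cases j <;> simp [tileDataB] at h0 h1 <;>
    refine ⟨plane_ext (by linarith) (by linarith), ?_⟩ <;> first
    | exact Or.inl rfl
    | exact Or.inr (Or.inl ⟨0, by linarith, by decide⟩)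
    | exact Or.inr (Or.inl ⟨1, by linarith, by decide⟩)
    | exact Or.inr (Or.inl ⟨2, by linarith, by decide⟩)
    | exact Or.inr (Or.inr ⟨0, 1, by decide, by linarith, by linarith⟩)
    | exact Or.inr (Or.inr ⟨0, 2, by decide, by linarith, by linarith⟩)
    | exact Or.inr (Or.inr ⟨1, 2, by decide, by linarith, by linarith⟩)

theorem tri_swap (p q s : EuclideanSpace ℝ (Fin 2)) : tri p q s = tri q p s := by
  rw [tri, tri, insert_comm]

theorem tri_rotate (p q s : EuclideanSpace ℝ (Fin 2)) : tri p q s = tri q s p := by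
  rw [tri, tri, insert_comm, pair_comm p s]

theorem latticeIsometry_image_tile {m : Fin 6 → ℤ} (hm : IsOrthogonalData m) (a b c d e f : ℤ)
    (h : m = ![a, b, c, d, e, f]) :
    latticeIsometry m hm '' tile =
      tri (pt c f) (pt (a + c) (d + f)) (pt ((a + b) / 2 + c) ((d + e) / 2 + f)) := by
  have h0 : m 0 = a := by rw [h]; rfl
  have h1 : m 1 = b := by rw [h]; rfl
  have h2 : m 2 = c := by rw [h]; rfl
  have h3 : m 3 = d := by rw [h]; rfl
  have h4 : m 4 = e := by rw [h]; rfl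
  have h5 : m 5 = f := by rw [h]; rfl
  rw [image_tile]
  simp only [latticeIsometry_apply, latticeMap, pt_apply_zero, pt_apply_one, h0, h1, h2, h3, h4, h5]
  congr 2 <;> ring

theorem iUnion_fin_seven {α : Type*} (f : Fin 7 → Set α) :
    ⋃ i, f i = f 0 ∪ f 1 ∪ f 2 ∪ f 3 ∪ f 4 ∪ f 5 ∪ f 6 := by
  ext x
  simp [Fin.exists_fin_succ, or_assoc]

theorem gwwA_eq : gwwA = interior (⋃ i, placeA i '' tile) := by
  have h0 : placeA 0 '' tile = tri (pt 0 0) (pt 0.5 0.5) (pt 0 1) := by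
    rw [tri_swap, tri_rotate]
    refine (latticeIsometry_image_tile (isOrthogonalData_tileDataA _) 0 1 0 1 0 0 rfl).trans ?_
    norm_num
  have h1 : placeA 1 '' tile = tri (pt 0 0) (pt 1 0) (pt 0.5 0.5) := by
    refine (latticeIsometry_image_tile (isOrthogonalData_tileDataA _) 1 0 0 0 1 0 rfl).trans ?_
    norm_num
  have h2 : placeA 2 '' tile = tri (pt 1 0) (pt 1 1) (pt 0.5 0.5) := by
    rw [tri_swap]
    refine (latticeIsometry_image_tile (isOrthogonalData_tileDataA _) 0 (-1) 1 (-1) 0 1 rfl).trans ?_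
    norm_num
  have h3 : placeA 3 '' tile = tri (pt 1 0) (pt 1.5 0.5) (pt 1 1) := by
    rw [← tri_rotate]
    refine (latticeIsometry_image_tile (isOrthogonalData_tileDataA _) 0 1 1 (-1) 0 1 rfl).trans ?_
    norm_num
  have h4 : placeA 4 '' tile = tri (pt 1.5 0.5) (pt 2 0) (pt 2 1) := by
    rw [tri_rotate]
    refine (latticeIsometry_image_tile (isOrthogonalData_tileDataA _) 0 (-1) 2 1 0 0 rfl).trans ?_
    norm_num
  have h5 : placeA 5 '' tile = tri (pt 1 1) (pt 1.5 0.5) (pt 2 1) := by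
    rw [tri_swap, tri_rotate]
    refine (latticeIsometry_image_tile (isOrthogonalData_tileDataA _) 1 0 1 0 (-1) 1 rfl).trans ?_
    norm_num
  have h6 : placeA 6 '' tile = tri (pt 1 1) (pt 2 1) (pt 1.5 1.5) := by
    refine (latticeIsometry_image_tile (isOrthogonalData_tileDataA _) 1 0 1 0 1 1 rfl).trans ?_
    norm_num
  rw [gwwA, iUnion_fin_seven, h0, h1, h2, h3, h4, h5, h6]

theorem gwwB_eq : gwwB = interior (⋃ i, placeB i '' tile) := by
  have h0 : placeB 0 '' tile = tri (pt 0 0) (pt 0.5 (-0.5)) (pt 1 0) := by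
    rw [← tri_rotate]
    refine (latticeIsometry_image_tile (isOrthogonalData_tileDataB _) (-1) 0 1 0 (-1) 0 rfl).trans ?_
    norm_num
  have h1 : placeB 1 '' tile = tri (pt 0 0) (pt 1 0) (pt 0.5 0.5) := by
    rw [tri_swap]
    refine (latticeIsometry_image_tile (isOrthogonalData_tileDataB _) (-1) 0 1 0 1 0 rfl).trans ?_
    norm_num
  have h2 : placeB 2 '' tile = tri (pt 0 0) (pt 0.5 0.5) (pt 0 1) := by
    rw [← tri_rotate]
    refine (latticeIsometry_image_tile (isOrthogonalData_tileDataB _) 0 1 0 (-1) 0 1 rfl).trans ?_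
    norm_num
  have h3 : placeB 3 '' tile = tri (pt 0 1) (pt 0.5 0.5) (pt 1 1) := by
    rw [tri_swap, tri_rotate]
    refine (latticeIsometry_image_tile (isOrthogonalData_tileDataB _) 1 0 0 0 (-1) 1 rfl).trans ?_
    norm_num
  have h4 : placeB 4 '' tile = tri (pt 0 1) (pt 1 1) (pt 0.5 1.5) := by
    refine (latticeIsometry_image_tile (isOrthogonalData_tileDataB _) 1 0 0 0 1 1 rfl).trans ?_
    norm_num
  have h5 : placeB 5 '' tile = tri (pt 0.5 1.5) (pt 1 1) (pt 1 2) := by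
    rw [tri_rotate, tri_swap]
    refine (latticeIsometry_image_tile (isOrthogonalData_tileDataB _) 0 (-1) 1 (-1) 0 2 rfl).trans ?_
    norm_num
  have h6 : placeB 6 '' tile = tri (pt 0 1) (pt 0.5 1.5) (pt 0 2) := by
    rw [tri_swap, tri_rotate]
    refine (latticeIsometry_image_tile (isOrthogonalData_tileDataB _) 0 1 0 1 0 1 rfl).trans ?_
    norm_num
  rw [gwwB, iUnion_fin_seven, h0, h1, h2, h3, h4, h5, h6]

theorem isGluedTiling_gwwA : IsGluedTiling gwwA tile tileSide gluingA placeA := by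
  rw [gwwA_eq]
  refine isGluedTiling_of_reflections (fun s i hs q => ?_) placeA_outer (by decide) placeA_meet
  exact latticeMap_comp_reflectionData (by revert s i; decide) q

theorem isGluedTiling_gwwB : IsGluedTiling gwwB tile tileSide gluingB placeB := by
  rw [gwwB_eq]
  refine isGluedTiling_of_reflections (fun s i hs q => ?_) placeB_outer (by decide) placeB_meet
  exact latticeMap_comp_reflectionData (by revert s i; decide) q

def intertwinerOne : Fin 7 → Fin 7 → ℤ :=
  ![![0, 0, 0, -1, -1, 1, 0], ![0, 0, -1, 0, 1, 0, 1], ![0, -1, 0, 0, 0, 1, -1],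
    ![-1, 0, 0, 1, 0, 0, 1], ![1, 0, 1, 0, 0, 1, 0], ![-1, 1, 0, 0, 1, 0, 0],
    ![0, 1, -1, 1, 0, 0, 0]]

def intertwinerTwo : Fin 7 → Fin 7 → ℤ :=
  ![![1, -1, 1, 0, 0, 0, -1], ![-1, 1, 0, 1, 0, -1, 0], ![1, 0, 1, -1, -1, 0, 0],
    ![0, 1, -1, 0, 1, -1, 0], ![0, -1, 0, -1, -1, 0, -1], ![0, 0, -1, 1, 0, -1, 1],
    ![-1, 0, 0, 0, 1, -1, 1]]

/-- The signs of the two-colouring of the tiles of `gwwA`. -/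
def tileColour : Fin 7 → ℤ := ![1, -1, 1, -1, -1, 1, -1]

/-- The transplantation matrix from `gwwA` to `gwwB`. -/
noncomputable def gwwMatrix (j i : Fin 7) : ℝ :=
  (1 - 2 * √2) / 7 * intertwinerOne j i + (2 + 3 * √2) / 14 * intertwinerTwo j i

theorem isTransplantation_gwwMatrix : IsTransplantation gluingA gluingB gwwMatrix where
  orthogonal i i' := by
    have h11 : ∀ i i', ∑ j, intertwinerOne j i * intertwinerOne j i' =
        (if i = i' then 2 else 0) + tileColour i * tileColour i' := by decide
    have h22 : ∀ i i', ∑ j, intertwinerTwo j i * intertwinerTwo j i' =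
        (if i = i' then 2 else 0) + 2 * (tileColour i * tileColour i') := by decide
    have h12 : ∀ i i', ∑ j, intertwinerOne j i * intertwinerTwo j i' =
        (if i = i' then -2 else 0) + 2 * (tileColour i * tileColour i') := by decide
    have h11 := congrArg (Int.cast : ℤ → ℝ) (h11 i i')
    have h22 := congrArg (Int.cast : ℤ → ℝ) (h22 i i')
    have h12' := congrArg (Int.cast : ℤ → ℝ) (h12 i' i)
    have h12 := congrArg (Int.cast : ℤ → ℝ) (h12 i i')
    push_cast at h11 h12 h12' h22
    have h : ∀ a b : ℝ, ∑ j, (a * intertwinerOne j i + b * intertwinerTwo j i) *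
        (a * intertwinerOne j i' + b * intertwinerTwo j i') =
        a ^ 2 * ∑ j, (intertwinerOne j i * intertwinerOne j i' : ℝ) +
        b ^ 2 * ∑ j, (intertwinerTwo j i * intertwinerTwo j i' : ℝ) +
        a * b * (∑ j, (intertwinerOne j i * intertwinerTwo j i' : ℝ) +
          ∑ j, (intertwinerOne j i' * intertwinerTwo j i : ℝ)) := fun a b => by
      simp only [Finset.mul_sum, ← Finset.sum_add_distrib]
      exact Finset.sum_congr rfl fun j _ => by ring
    have hsq : √2 * √2 = 2 := Real.mul_self_sqrt (by norm_num)
    simp only [gwwMatrix]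
    rw [h, h11, h22, h12, h12']
    by_cases hi : i = i'
    · subst hi
      simp only [if_true]
      have : (tileColour i * tileColour i : ℝ) = 1 := by
        have : ∀ i, tileColour i * tileColour i = 1 := by decide
        exact_mod_cast this i
      rw [this]
      linear_combination (3 / 7) * hsq
    · simp only [if_neg hi, if_neg (Ne.symm hi)]
      linear_combination -(tileColour i * tileColour i' / 14 : ℝ) * hsq
  intertwine s j i := by
    have h1 : ∀ s j i, intertwinerOne (gluingB s j) i = (if gluingB s j = j then -1 else 1) *
        (if gluingA s i = i then -1 else 1) * intertwinerOne j (gluingA s i) := by decide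
    have h2 : ∀ s j i, intertwinerTwo (gluingB s j) i = (if gluingB s j = j then -1 else 1) *
        (if gluingA s i = i then -1 else 1) * intertwinerTwo j (gluingA s i) := by decide
    simp only [gwwMatrix, boundarySign]
    rw [h1, h2]
    push_cast
    ring

theorem dirichletEig_gwwA_eq {k : ℕ} (hk : 1 ≤ k) : dirichletEig gwwA k = dirichletEig gwwB k :=
  dirichletEig_eq_of_isTransplantation hk convex_tile isCompact_tile isOpen_interior
    isOpen_interior isGluedTiling_gwwA isGluedTiling_gwwB (fun s i => by revert s i; decide)
    (fun s i => by revert s i; decide) isTransplantation_gwwMatrix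

end GordonWebbWolpert

section NotIsometric

open Set

/-- The vertices of the polygon bounding `gwwA`. -/
noncomputable def vertexA : Fin 9 → EuclideanSpace ℝ (Fin 2) :=
  ![pt 0 0, pt 1 0, pt 1.5 0.5, pt 2 0, pt 2 1, pt 1.5 1.5, pt 0.5 0.5, pt 0 1, pt 1 1]

theorem gwwA_subset_convexHull : gwwA ⊆ convexHull ℝ (range vertexA) := by
  have key (i j k : Fin 9) : tri (vertexA i) (vertexA j) (vertexA k) ⊆
      convexHull ℝ (range vertexA) := by
    refine convexHull_mono ?_
    rintro _ (rfl | rfl | rfl) <;> exact mem_range_self _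
  refine interior_subset.trans ?_
  refine union_subset (union_subset (union_subset (union_subset (union_subset (union_subset
    (key 0 6 7) (key 0 1 6)) (key 1 8 6)) (key 1 2 8)) (key 2 3 4)) (key 8 2 4)) (key 8 4 5)

theorem dist_sq_le_of_mem_gwwA {p q : EuclideanSpace ℝ (Fin 2)} (hp : p ∈ gwwA) (hq : q ∈ gwwA) :
    dist p q ^ 2 ≤ 5 := by
  obtain ⟨_, ⟨i, rfl⟩, _, ⟨j, rfl⟩, h⟩ :=
    convexHull_exists_dist_ge2 (gwwA_subset_convexHull hp) (gwwA_subset_convexHull hq)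
  refine (pow_le_pow_left₀ dist_nonneg h 2).trans ?_
  rw [dist_sq_plane]
  fin_cases i <;> fin_cases j <;> simp [vertexA, pt_apply_zero, pt_apply_one] <;> norm_num

theorem placeB_mem_gwwB (i : Fin 7) {p : EuclideanSpace ℝ (Fin 2)} (h0 : 0 < p 1)
    (h1 : 0 < p 0 - p 1) (h2 : 0 < 1 - p 0 - p 1) : placeB i p ∈ gwwB := by
  have hp : p ∈ interior tile := by
    refine mem_interior_tile (mem_tile.2 ⟨h0.le, h1.le, h2.le⟩) fun s hs => ?_
    have := hs.2
    fin_cases s <;> simp [sideForm] at this <;> linarith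
  rw [gwwB_eq]
  refine interior_mono (subset_iUnion _ i) ?_
  have := mem_image_of_mem (placeB i).toHomeomorph hp
  rwa [(placeB i).toHomeomorph.image_interior] at this

theorem exists_dist_sq_gt_of_mem_gwwB : ∃ p ∈ gwwB, ∃ q ∈ gwwB, 5 < dist p q ^ 2 := by
  have h0 : placeB 0 (pt 0.5 0.4) = pt 0.5 (-0.4) := by
    rw [placeB, latticeIsometry_apply, latticeMap, pt_apply_zero, pt_apply_one]
    simp [tileDataB]
    norm_num
  have h5 : placeB 5 (pt 0.1 0.05) = pt 0.95 1.9 := by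
    rw [placeB, latticeIsometry_apply, latticeMap, pt_apply_zero, pt_apply_one]
    simp [tileDataB]
    norm_num
  refine ⟨_, placeB_mem_gwwB 0 (p := pt 0.5 0.4) ?_ ?_ ?_, _,
    placeB_mem_gwwB 5 (p := pt 0.1 0.05) ?_ ?_ ?_, ?_⟩
  rotate_right
  · rw [h0, h5, dist_sq_plane]
    simp only [pt_apply_zero, pt_apply_one]
    norm_num
  all_goals
    simp only [pt_apply_zero, pt_apply_one]
    norm_num

theorem not_exists_isometry_gww :
    ¬ ∃ f : EuclideanSpace ℝ (Fin 2) ≃ᵢ EuclideanSpace ℝ (Fin 2), f '' gwwA = gwwB := by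
  rintro ⟨f, hf⟩
  obtain ⟨p, hp, q, hq, hpq⟩ := exists_dist_sq_gt_of_mem_gwwB
  rw [← hf] at hp hq
  obtain ⟨a, ha, rfl⟩ := hp
  obtain ⟨b, hb, rfl⟩ := hq
  rw [f.isometry.dist_eq] at hpq
  exact hpq.not_ge (dist_sq_le_of_mem_gwwA ha hb)

end NotIsometric

/-- Gordon–Webb–Wolpert: one cannot hear the shape of a drum, Dirichlet case:
the two GWW polygons are not isometric, yet Dirichlet isospectral. -/
theorem gww_dirichlet_isospectral :
    (¬ ∃ f : EuclideanSpace ℝ (Fin 2) ≃ᵢ EuclideanSpace ℝ (Fin 2), f '' gwwA = gwwB) ∧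
      ∀ k : ℕ, 1 ≤ k → dirichletEig gwwA k = dirichletEig gwwB k := by
  exact ⟨not_exists_isometry_gww, fun k hk => dirichletEig_gwwA_eq hk⟩
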